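/- arXiv:math-ph/0307062 — 3 statements merged into one kernel-verified Lean document; each statement's English description precedes it below -/
import Mathlib

section
/- Pastur–Šubin convergence criterion: Let λ₀ ∈ ℝ and let (μ_l)_{l∈ℕ} be a sequence of Borel measures on ℝ with μ_l((−∞,λ₀)) = 0 for every l, such that (ii) for every t > 0 there is a constant C(t) < ∞ with L_l(t) := ∫_ℝ e^{−tλ} dμ_l(λ) ≤ C(t) for all l, and (iii) for every t > 0 the limit L(t) := lim_{l→∞} L_l(t) exists. Then there exists a Borel measure μ on ℝ with μ((−∞,λ₀)) = 0 such that ∫_ℝ e^{−tλ} dμ(λ) = L(t) for all t > 0, and for every λ ∈ ℝ with μ({λ}) = 0 one has lim_{l→∞} μ_l((−∞,λ)) = μ((−∞,λ)). -/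
open MeasureTheory Filter Topology ENNReal

open scoped CompactlySupported

/-- Vague convergence from convergence of integrals of compactly supported functions. -/
theorem ps_exists_vague_limit (μs : ℕ → Measure ℝ) [∀ l, IsFiniteMeasureOnCompacts (μs l)]
    (hc : ∀ f : C_c(ℝ, ℝ), ∃ x, Tendsto (fun l => ∫ y, f y ∂(μs l)) atTop (𝓝 x)) :
    ∃ μ : Measure ℝ, μ.Regular ∧ ∀ f : C_c(ℝ, ℝ),
      Tendsto (fun l => ∫ y, f y ∂(μs l)) atTop (𝓝 (∫ y, f y ∂μ)) := by
  choose Λ hΛ using hc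
  have hint : ∀ (g : C_c(ℝ, ℝ)) l, Integrable g (μs l) := fun g l =>
    g.continuous.integrable_of_hasCompactSupport g.hasCompactSupport
  let Λ' : C_c(ℝ, ℝ) →ₚ[ℝ] ℝ :=
  { toFun := Λ
    map_add' g g' := by
      have : Tendsto (fun l ↦ ∫ x, g x + g' x ∂(μs l)) atTop (𝓝 (Λ g + Λ g')) := by
        refine ((hΛ g).add (hΛ g')).congr fun l => ?_
        rw [integral_add (hint g l) (hint g' l)]
      exact tendsto_nhds_unique (hΛ (g + g')) this
    map_smul' c g := by
      have : Tendsto (fun l ↦ ∫ x, c • g x ∂(μs l)) atTop (𝓝 (c • Λ g)) := by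
        refine ((hΛ g).const_smul c).congr fun l => ?_
        rw [integral_smul]
      exact tendsto_nhds_unique (hΛ (c • g)) this
    monotone' g g' hgg' := by
      refine le_of_tendsto_of_tendsto' (hΛ g) (hΛ g') fun l => ?_
      exact integral_mono (hint g l) (hint g' l) hgg' }
  refine ⟨RealRMK.rieszMeasure Λ', inferInstance, fun f => ?_⟩
  rw [RealRMK.integral_rieszMeasure]
  exact hΛ f

theorem ps_poly (μs : ℕ → Measure ℝ)
    (hi : ∀ t : ℝ, 0 < t → ∀ l, Integrable (fun x => Real.exp (-t * x)) (μs l))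
    (hconv : ∀ t : ℝ, 0 < t → ∃ L : ℝ,
      Tendsto (fun l => ∫ x, Real.exp (-t * x) ∂(μs l)) atTop (𝓝 L))
    (p : Polynomial ℝ) :
    (∀ l, Integrable (fun x => Real.exp (-1 * x) * p.eval (Real.exp (-x))) (μs l)) ∧
    ∃ L : ℝ, Tendsto (fun l => ∫ x, Real.exp (-1 * x) * p.eval (Real.exp (-x)) ∂(μs l))
      atTop (𝓝 L) := by
  induction p using Polynomial.induction_on' with
  | add p q hp hq =>
    obtain ⟨hp1, Lp, hp2⟩ := hp
    obtain ⟨hq1, Lq, hq2⟩ := hq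
    simp only [Polynomial.eval_add, mul_add]
    refine ⟨fun l => (hp1 l).add (hq1 l), Lp + Lq, ?_⟩
    refine (hp2.add hq2).congr fun l => ?_
    rw [integral_add (hp1 l) (hq1 l)]
  | monomial n a =>
    have h : ∀ x : ℝ, Real.exp (-1 * x) * (Polynomial.monomial n a).eval (Real.exp (-x))
        = a * Real.exp (-((n : ℝ) + 1) * x) := by
      intro x
      rw [Polynomial.eval_monomial, ← Real.exp_nat_mul, mul_left_comm, ← Real.exp_add]
      congr 2
      ring
    simp only [h]
    have hn : (0 : ℝ) < (n : ℝ) + 1 := by positivity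
    obtain ⟨L, hL⟩ := hconv _ hn
    refine ⟨fun l => (hi _ hn l).const_mul a, a * L, ?_⟩
    simp only [integral_const_mul]
    exact hL.const_mul a

theorem ps_transform_continuous (f : C_c(ℝ, ℝ)) :
    ∃ g : ℝ → ℝ, Continuous g ∧ ∀ x, f x = Real.exp (-1 * x) * g (Real.exp (-x)) := by
  obtain ⟨R, hR⟩ := f.hasCompactSupport.isCompact.isBounded.subset_closedBall 0
  refine ⟨fun x => if x ≤ 0 then 0 else x⁻¹ * f (-Real.log x), ?_, ?_⟩
  · rw [continuous_iff_continuousAt]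
    intro x
    rcases lt_or_ge 0 x with hx | hx
    · have : ContinuousAt (fun x : ℝ => x⁻¹ * f (-Real.log x)) x :=
        (continuousAt_inv₀ hx.ne').mul
          (f.continuous.continuousAt.comp (Real.continuousAt_log hx.ne').neg)
      refine this.congr ?_
      filter_upwards [lt_mem_nhds hx] with y hy
      simp [hy.not_ge]
    · have : ContinuousAt (fun _ : ℝ => (0 : ℝ)) x := continuousAt_const
      refine this.congr ?_
      have hx' : x < Real.exp (-(|R| + 1)) := hx.trans_lt (Real.exp_pos _)
      filter_upwards [gt_mem_nhds hx'] with y hy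
      split_ifs with h
      · rfl
      · push Not at h
        have h1 : Real.log y < -(|R| + 1) := (Real.log_lt_iff_lt_exp h).2 hy
        have : f (-Real.log y) = 0 := by
          apply image_eq_zero_of_notMem_tsupport
          intro hmem
          have := hR hmem
          rw [Metric.mem_closedBall, dist_zero_right, Real.norm_eq_abs] at this
          have h2 := le_abs_self (-Real.log y)
          have h3 := le_abs_self R
          linarith
        simp [this]
  · intro x
    have := Real.exp_pos (-x)
    simp only [this.not_ge, if_false, Real.log_exp, neg_neg, neg_mul, one_mul]
    rw [← mul_assoc, mul_inv_cancel₀ this.ne', one_mul]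

theorem ps_conv_compact (lam0 : ℝ) (μs : ℕ → Measure ℝ)
    [∀ l, IsFiniteMeasureOnCompacts (μs l)]
    (h0 : ∀ l, μs l (Set.Iio lam0) = 0)
    (hi : ∀ t : ℝ, 0 < t → ∀ l, Integrable (fun x => Real.exp (-t * x)) (μs l))
    (hconv : ∀ t : ℝ, 0 < t → ∃ L : ℝ,
      Tendsto (fun l => ∫ x, Real.exp (-t * x) ∂(μs l)) atTop (𝓝 L))
    (f : C_c(ℝ, ℝ)) : ∃ x, Tendsto (fun l => ∫ y, f y ∂(μs l)) atTop (𝓝 x) := by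
  obtain ⟨g, hg, hfg⟩ := ps_transform_continuous f
  obtain ⟨L1, hL1⟩ := hconv 1 one_pos
  obtain ⟨C, hC⟩ := hL1.bddAbove_range
  have hC' : ∀ l, ∫ x, Real.exp (-1 * x) ∂(μs l) ≤ C := fun l => hC ⟨l, rfl⟩
  have hC0 : 0 ≤ C := le_trans (integral_nonneg fun x => (Real.exp_pos _).le) (hC' 0)
  have hae : ∀ l, ∀ᵐ x ∂(μs l), lam0 ≤ x := by
    intro l
    rw [ae_iff]
    simpa [Set.Iio] using h0 l
  have key : ∀ ε > 0, ∃ p : Polynomial ℝ, ∀ l,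
      |(∫ y, f y ∂(μs l)) - ∫ x, Real.exp (-1 * x) * p.eval (Real.exp (-x)) ∂(μs l)| ≤ ε * C := by
    intro ε hε
    obtain ⟨p, hp⟩ := exists_polynomial_near_of_continuousOn 0 (Real.exp (-lam0)) g
      hg.continuousOn ε hε
    refine ⟨p, fun l => ?_⟩
    have hfi : Integrable (fun y => f y) (μs l) :=
      f.continuous.integrable_of_hasCompactSupport f.hasCompactSupport
    rw [← integral_sub hfi
      ((ps_poly μs hi hconv p).1 l), ← Real.norm_eq_abs]
    calc _ ≤ ∫ x, ε * Real.exp (-1 * x) ∂(μs l) := by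
          refine norm_integral_le_of_norm_le ((hi 1 one_pos l).const_mul ε) ?_
          filter_upwards [hae l] with x hx
          rw [hfg x, ← mul_sub, norm_mul, Real.norm_eq_abs, Real.abs_exp, mul_comm,
            Real.norm_eq_abs, abs_sub_comm]
          exact mul_le_mul_of_nonneg_right
            (hp _ ⟨(Real.exp_pos _).le, Real.exp_le_exp.2 (by linarith)⟩).le (Real.exp_pos _).le
      _ ≤ ε * C := by
          rw [integral_const_mul]
          exact mul_le_mul_of_nonneg_left (hC' l) hε.le
  apply cauchySeq_tendsto_of_complete
  rw [Metric.cauchySeq_iff']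
  intro ε hε
  obtain ⟨p, hp⟩ := key (ε / (4 * (C + 1))) (by positivity)
  obtain ⟨-, L, hL⟩ := ps_poly μs hi hconv p
  obtain ⟨N, hN⟩ := Metric.cauchySeq_iff'.1 hL.cauchySeq (ε / 2) (by positivity)
  have hsm : ε / (4 * (C + 1)) * C < ε / 4 := by
    rw [div_mul_eq_mul_div, div_lt_div_iff₀ (by positivity) (by positivity)]
    nlinarith
  refine ⟨N, fun n hn => ?_⟩
  have h1 := hN n hn
  have h2 := hp n
  have h3 := hp N
  rw [Real.dist_eq] at h1 ⊢
  rw [abs_lt] at h1 ⊢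
  rw [abs_le] at h2 h3
  constructor <;> linarith [h1.1, h1.2, h2.1, h2.2, h3.1, h3.2]

theorem ps_lintegral_conv (μs : ℕ → Measure ℝ) (μ : Measure ℝ)
    [∀ l, IsFiniteMeasureOnCompacts (μs l)] [IsFiniteMeasureOnCompacts μ]
    (hc : ∀ f : C_c(ℝ, ℝ), Tendsto (fun l => ∫ y, f y ∂(μs l)) atTop (𝓝 (∫ y, f y ∂μ)))
    (f : ℝ → ℝ) (hf : Continuous f) (hfs : HasCompactSupport f) (hnn : ∀ x, 0 ≤ f x) :
    Tendsto (fun l => ∫⁻ y, ENNReal.ofReal (f y) ∂(μs l)) atTop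
      (𝓝 (∫⁻ y, ENNReal.ofReal (f y) ∂μ)) := by
  have h := ENNReal.tendsto_ofReal (hc ⟨⟨f, hf⟩, hfs⟩)
  have e : ∀ (ν : Measure ℝ) [IsFiniteMeasureOnCompacts ν],
      ENNReal.ofReal (∫ y, f y ∂ν) = ∫⁻ y, ENNReal.ofReal (f y) ∂ν := fun ν _ =>
    ofReal_integral_eq_lintegral_ofReal (hf.integrable_of_hasCompactSupport hfs)
      (Eventually.of_forall hnn)
  rw [← e μ]
  refine h.congr fun l => ?_
  exact e (μs l)

theorem ps_open (μs : ℕ → Measure ℝ) (μ : Measure ℝ) [μ.Regular]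
    (hc : ∀ f : ℝ → ℝ, Continuous f → HasCompactSupport f → (∀ x, 0 ≤ f x) →
      Tendsto (fun l => ∫⁻ y, ENNReal.ofReal (f y) ∂(μs l)) atTop
      (𝓝 (∫⁻ y, ENNReal.ofReal (f y) ∂μ)))
    (K U : Set ℝ) (hK : IsCompact K) (hU : IsOpen U) (hKU : K ⊆ U) :
    μ K ≤ liminf (fun l => μs l U) atTop ∧ limsup (fun l => μs l K) atTop ≤ μ U := by
  obtain ⟨f, hf1, hf2, hf3, hf4⟩ := exists_continuousMap_one_of_isCompact_subset_isOpen hK hU hKU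
  have hlim := hc f f.continuous hf2 (fun x => (hf4 x).1)
  have hlow : ∀ ν : Measure ℝ, ν K ≤ ∫⁻ y, ENNReal.ofReal (f y) ∂ν := by
    intro ν
    rw [← lintegral_indicator_one hK.measurableSet]
    refine lintegral_mono fun x => ?_
    by_cases hx : x ∈ K
    · simp [hx, hf1 hx]
    · simp [hx]
  have hup : ∀ ν : Measure ℝ, ∫⁻ y, ENNReal.ofReal (f y) ∂ν ≤ ν U := by
    intro ν
    rw [← lintegral_indicator_one hU.measurableSet]
    refine lintegral_mono fun x => ?_
    by_cases hx : x ∈ U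
    · simpa [hx] using (hf4 x).2
    · have : f x = 0 := image_eq_zero_of_notMem_tsupport fun h => hx (hf3 h)
      simp [hx, this]
  constructor
  · calc μ K ≤ _ := hlow μ
      _ = _ := hlim.liminf_eq.symm
      _ ≤ _ := liminf_le_liminf (Eventually.of_forall fun l => hup (μs l))
  · calc _ ≤ _ := limsup_le_limsup (Eventually.of_forall fun l => hlow (μs l))
      _ = _ := hlim.limsup_eq
      _ ≤ _ := hup μ

/-- Pastur–Šubin convergence criterion. -/
theorem pastur_subin_convergence
    (lam0 : ℝ) (μs : ℕ → Measure ℝ)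
    (h0 : ∀ l, μs l (Set.Iio lam0) = 0)
    (hbound : ∀ t : ℝ, 0 < t → ∃ C : ℝ≥0∞, C ≠ ⊤ ∧
      ∀ l, (∫⁻ lam, ENNReal.ofReal (Real.exp (-t * lam)) ∂(μs l)) ≤ C)
    (hconv : ∀ t : ℝ, 0 < t → ∃ L : ℝ≥0∞,
      Tendsto (fun l => ∫⁻ lam, ENNReal.ofReal (Real.exp (-t * lam)) ∂(μs l)) atTop (𝓝 L)) :
    ∃ μ : Measure ℝ, μ (Set.Iio lam0) = 0 ∧
      (∀ t : ℝ, 0 < t →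
        Tendsto (fun l => ∫⁻ lam, ENNReal.ofReal (Real.exp (-t * lam)) ∂(μs l)) atTop
          (𝓝 (∫⁻ lam, ENNReal.ofReal (Real.exp (-t * lam)) ∂μ))) ∧
      (∀ lam : ℝ, μ {lam} = 0 →
        Tendsto (fun l => μs l (Set.Iio lam)) atTop (𝓝 (μ (Set.Iio lam)))) := by
  have hi : ∀ t : ℝ, 0 < t → ∀ l, Integrable (fun x => Real.exp (-t * x)) (μs l) := by
    intro t ht l
    obtain ⟨C, hC, hCl⟩ := hbound t ht
    refine ⟨(by fun_prop : Continuous fun x : ℝ => Real.exp (-t * x)).aestronglyMeasurable, ?_⟩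
    rw [hasFiniteIntegral_iff_ofReal (Eventually.of_forall fun x => (Real.exp_pos _).le)]
    exact (hCl l).trans_lt hC.lt_top
  have hconvR : ∀ t : ℝ, 0 < t → ∃ L : ℝ,
      Tendsto (fun l => ∫ x, Real.exp (-t * x) ∂(μs l)) atTop (𝓝 L) := by
    intro t ht
    obtain ⟨C, hC, hCl⟩ := hbound t ht
    obtain ⟨L, hL⟩ := hconv t ht
    have hLt : L ≠ ⊤ := ((le_of_tendsto' hL hCl).trans_lt hC.lt_top).ne
    refine ⟨L.toReal, ((ENNReal.tendsto_toReal hLt).comp hL).congr fun l => ?_⟩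
    rw [integral_eq_lintegral_of_nonneg_ae (Eventually.of_forall fun x => (Real.exp_pos _).le)
      (hi t ht l).aestronglyMeasurable]
    rfl
  have : ∀ l, IsFiniteMeasureOnCompacts (μs l) := by
    intro l
    refine ⟨fun K hK => ?_⟩
    obtain ⟨R, hR⟩ := hK.isBounded.subset_closedBall 0
    obtain ⟨C, hC, hCl⟩ := hbound 1 one_pos
    have h1 : ENNReal.ofReal (Real.exp (-R)) * μs l K ≤ C := by
      refine le_trans ?_ (hCl l)
      refine le_trans ?_ (mul_meas_ge_le_lintegral₀ (by fun_prop) (ENNReal.ofReal (Real.exp (-R))))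
      gcongr
      intro x hx
      have := hR hx
      rw [Metric.mem_closedBall, dist_zero_right, Real.norm_eq_abs] at this
      have h2 := le_abs_self x
      exact ENNReal.ofReal_le_ofReal (Real.exp_le_exp.2 (by linarith))
    by_contra hcon
    have htop : μs l K = ⊤ := by simpa using hcon
    rw [htop, ENNReal.mul_top (by simpa using Real.exp_pos _)] at h1
    exact hC (top_le_iff.1 h1)
  obtain ⟨μ, hreg, hμ⟩ := ps_exists_vague_limit μs
    (ps_conv_compact lam0 μs h0 hi hconvR)
  have hlint := ps_lintegral_conv μs μ hμ
  have hKU := ps_open μs μ hlint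
  have hopen : ∀ U, IsOpen U → μ U ≤ liminf (fun l => μs l U) atTop := by
    intro U hU
    rw [hU.measure_eq_iSup_isCompact]
    exact iSup₂_le fun K hKs => iSup_le fun hK => (hKU K U hK hU hKs).1
  have hcomp : ∀ K, IsCompact K → limsup (fun l => μs l K) atTop ≤ μ K := by
    intro K hK
    rw [K.measure_eq_iInf_isOpen μ]
    exact le_iInf₂ fun U hKs => le_iInf fun hU => (hKU K U hK hU hKs).2
  refine ⟨μ, ?_, ?_, ?_⟩
  · have := hopen _ (isOpen_Iio (a := lam0))
    simpa [h0] using this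
  · intro t ht
    refine tendsto_of_le_liminf_of_limsup_le
      (lintegral_le_liminf_lintegral_of_forall_isOpen_measure_le_liminf_measure
        (by fun_prop) (fun x => (Real.exp_pos _).le) hopen) ?_
    obtain ⟨C, hC, hCl⟩ := hbound (t / 2) (half_pos ht)
    have hR : ∀ R : ℝ, limsup (fun l => ∫⁻ lam, ENNReal.ofReal (Real.exp (-t * lam)) ∂(μs l)) atTop
        ≤ (∫⁻ lam, ENNReal.ofReal (Real.exp (-t * lam)) ∂μ)
          + ENNReal.ofReal (Real.exp (-(t / 2) * R)) * C := by
      intro R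
      obtain ⟨f, hf1, hf2, hf3, hf4⟩ := exists_continuousMap_one_of_isCompact_subset_isOpen
        (isCompact_Icc (a := lam0) (b := R)) isOpen_univ (Set.subset_univ _)
      have hlim := hlint (fun x => f x * Real.exp (-t * x)) (by fun_prop)
        (HasCompactSupport.mul_right hf2) (fun x => mul_nonneg (hf4 x).1 (Real.exp_pos _).le)
      have hlim2 := hlim.add_const (ENNReal.ofReal (Real.exp (-(t / 2) * R)) * C)
      calc _ ≤ _ := limsup_le_limsup (Eventually.of_forall fun l => ?_)
        _ = _ := hlim2.limsup_eq
        _ ≤ _ := by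
          gcongr with x
          exact mul_le_of_le_one_left (Real.exp_pos _).le (hf4 x).2
      show (∫⁻ lam, ENNReal.ofReal (Real.exp (-t * lam)) ∂(μs l)) ≤ _
      calc _ ≤ ∫⁻ x, (ENNReal.ofReal (f x * Real.exp (-t * x)) +
              ENNReal.ofReal (Real.exp (-(t / 2) * R)) *
                ENNReal.ofReal (Real.exp (-(t / 2) * x))) ∂(μs l) := by
            refine lintegral_mono_ae ?_
            have hae : ∀ᵐ x ∂(μs l), lam0 ≤ x := by
              rw [ae_iff]
              simpa [Set.Iio] using h0 l
            filter_upwards [hae] with x hx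
            rcases le_or_gt x R with hxR | hxR
            · have : f x = 1 := hf1 ⟨hx, hxR⟩
              rw [this, one_mul]
              exact le_self_add
            · refine le_trans ?_ le_add_self
              rw [← ENNReal.ofReal_mul (Real.exp_pos _).le, ← Real.exp_add]
              refine ENNReal.ofReal_le_ofReal (Real.exp_le_exp.2 ?_)
              nlinarith
        _ ≤ _ := by
            rw [lintegral_add_left (by fun_prop), lintegral_const_mul _ (by fun_prop)]
            gcongr
            exact hCl l
    have hz : Tendsto (fun R : ℝ => (∫⁻ lam, ENNReal.ofReal (Real.exp (-t * lam)) ∂μ)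
          + ENNReal.ofReal (Real.exp (-(t / 2) * R)) * C) atTop
        (𝓝 ((∫⁻ lam, ENNReal.ofReal (Real.exp (-t * lam)) ∂μ) + 0 * C)) := by
      refine Tendsto.const_add _ (ENNReal.Tendsto.mul_const ?_ (Or.inr hC))
      rw [← ENNReal.ofReal_zero]
      refine ENNReal.tendsto_ofReal (Real.tendsto_exp_atBot.comp ?_)
      exact tendsto_id.const_mul_atTop_of_neg (by linarith)
    simpa using ge_of_tendsto' hz hR
  · intro lam hlam
    refine tendsto_of_le_liminf_of_limsup_le (hopen _ isOpen_Iio) ?_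
    calc _ ≤ limsup (fun l => μs l (Set.Icc lam0 lam)) atTop := by
          refine limsup_le_limsup (Eventually.of_forall fun l => ?_)
          show μs l (Set.Iio lam) ≤ μs l (Set.Icc lam0 lam)
          calc _ ≤ μs l (Set.Iio lam0 ∪ Set.Icc lam0 lam) := by
                refine measure_mono fun x hx => ?_
                rcases lt_or_ge x lam0 with h | h
                · exact Or.inl h
                · exact Or.inr ⟨h, le_of_lt hx⟩
            _ ≤ _ := measure_union_le _ _
            _ = _ := by rw [h0, zero_add]
      _ ≤ μ (Set.Icc lam0 lam) := hcomp _ isCompact_Icc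
      _ ≤ μ (Set.Iio lam ∪ {lam}) := by
          refine measure_mono fun x hx => ?_
          rcases lt_or_eq_of_le hx.2 with h | h
          · exact Or.inl h
          · exact Or.inr h
      _ ≤ _ := measure_union_le _ _
      _ = _ := by rw [hlam, add_zero]
end

section
/- For every M ≥ 0 and every s ∈ (0,1) there exists a constant c > 0, depending only on M and s, with the following property: for every a ∈ ℝ, every measurable W : ℝ → ℝ with |W(x)| ≤ M for all x ∈ [a − 1/2, a + 1/2], and all functions ψ, ψ̃ : ℝ → ℂ such that at every x ∈ [a − 1/2, a + 1/2] the function ψ is differentiable with derivative ψ̃(x) and ψ̃ is differentiable with derivative W(x)·ψ(x) (i.e. ψ solves −ψ″ + Wψ = 0 on the interval), one has ∫_{a−s/2}^{a+s/2} |ψ(x)|² dx ≥ c · ∫_{a−1/2}^{a+1/2} |ψ(x)|² dx. -/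
open Set in
/-- Growth bound for the energy. -/
lemma energy_growth (K : ℝ) (p q : ℝ) (E E' : ℝ → ℝ) (hK : 0 ≤ K) (hpq : q - p ≤ 1)
    (hE0 : ∀ x, 0 ≤ E x)
    (hE : ∀ x ∈ Icc p q, HasDerivAt E (E' x) x)
    (hb : ∀ x ∈ Icc p q, |E' x| ≤ K * E x) :
    ∀ x ∈ Icc p q, ∀ y ∈ Icc p q, E y ≤ Real.exp K * E x := by
  have hd : ∀ k : ℝ, ∀ x ∈ Icc p q, HasDerivAt (fun x => Real.exp (k * x) * E x)
      (Real.exp (k * x) * (k * E x + E' x)) x := by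
    intro k x hx
    have h1 : HasDerivAt (fun x : ℝ => Real.exp (k * x)) (Real.exp (k * x) * (k * 1)) x :=
      ((hasDerivAt_id x).const_mul k).exp
    have h2 := h1.mul (hE x hx)
    have e : Real.exp (k * x) * (k * E x + E' x)
        = Real.exp (k * x) * (k * 1) * E x + Real.exp (k * x) * E' x := by ring
    rw [e]
    exact h2
  have hmono : MonotoneOn (fun x => Real.exp (K * x) * E x) (Icc p q) := by
    apply monotoneOn_of_deriv_nonneg (convex_Icc p q)
    · exact fun x hx => (hd K x hx).continuousAt.continuousWithinAt
    · exact fun x hx => (hd K x (interior_subset hx)).differentiableAt.differentiableWithinAt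
    · intro x hx
      have hx := interior_subset hx
      rw [(hd K x hx).deriv]
      have := (abs_le.1 (hb x hx)).1
      exact mul_nonneg (Real.exp_pos _).le (by linarith)
  have hanti : AntitoneOn (fun x => Real.exp (-K * x) * E x) (Icc p q) := by
    apply antitoneOn_of_deriv_nonpos (convex_Icc p q)
    · exact fun x hx => (hd (-K) x hx).continuousAt.continuousWithinAt
    · exact fun x hx => (hd (-K) x (interior_subset hx)).differentiableAt.differentiableWithinAt
    · intro x hx
      have hx := interior_subset hx
      rw [(hd (-K) x hx).deriv]
      have := (abs_le.1 (hb x hx)).2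
      exact mul_nonpos_of_nonneg_of_nonpos (Real.exp_pos _).le (by linarith)
  have key : ∀ k d u v : ℝ, Real.exp (k * v) * E v ≤ Real.exp (k * u) * E u →
      k * (u - v) ≤ K → E v ≤ Real.exp K * E u := by
    intro k d u v h1 h2
    have e1 : Real.exp (k * u) = Real.exp (k * v) * Real.exp (k * (u - v)) := by
      rw [← Real.exp_add]; congr 1; ring
    rw [e1, mul_assoc] at h1
    have h3 := le_of_mul_le_mul_left h1 (Real.exp_pos _)
    exact h3.trans (mul_le_mul_of_nonneg_right (Real.exp_le_exp.2 h2) (hE0 u))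
  intro x hx y hy
  rcases le_total x y with h | h
  · refine key (-K) 0 x y (hanti hx hy h) ?_
    nlinarith [hx.1, hy.2]
  · refine key K 0 x y (hmono hy hx h) ?_
    nlinarith [hx.2, hy.1]

/-- One-dimensional quantitative unique continuation for `-ψ'' + W ψ = 0`. -/
theorem one_dim_unique_continuation
    (M : ℝ) (hM : 0 ≤ M) (s : ℝ) (hs : s ∈ Set.Ioo (0:ℝ) 1) :
    ∃ c : ℝ, 0 < c ∧
      ∀ (a : ℝ) (W : ℝ → ℝ), Measurable W →
        (∀ x ∈ Set.Icc (a - 1/2) (a + 1/2), |W x| ≤ M) →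
        ∀ (ψ ψ' : ℝ → ℂ),
          (∀ x ∈ Set.Icc (a - 1/2) (a + 1/2), HasDerivAt ψ (ψ' x) x) →
          (∀ x ∈ Set.Icc (a - 1/2) (a + 1/2), HasDerivAt ψ' ((W x : ℂ) * ψ x) x) →
          c * ∫ x in (a - 1/2)..(a + 1/2), ‖ψ x‖^2 ≤
            ∫ x in (a - s/2)..(a + s/2), ‖ψ x‖^2 := by
  obtain ⟨hs0, hs1⟩ := hs
  set m : ℝ := ∫ t in (-(s/2))..(s/2), ((s/2)^2 - t^2)^2 with hm
  have hmpos : 0 < m := by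
    apply intervalIntegral.intervalIntegral_pos_of_pos_on
    · exact Continuous.intervalIntegrable (by fun_prop) _ _
    · intro x hx
      have : 0 < (s/2)^2 - x^2 := by nlinarith [hx.1, hx.2]
      positivity
    · linarith
  refine ⟨m * Real.exp (-(1+M)) / (2 * (3 + M)), by positivity, ?_⟩
  intro a W _ hW ψ ψ' h1 h2
  set E : ℝ → ℝ := fun x => ‖ψ x‖^2 + ‖ψ' x‖^2 with hEdef
  have hin : ∀ x, inner ℝ (ψ' x) ((W x : ℂ) * ψ x) = W x * inner ℝ (ψ x) (ψ' x) := by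
    intro x
    rw [← Complex.real_smul, real_inner_smul_right, real_inner_comm]
  have hgrow := energy_growth (1+M) (a-1/2) (a+1/2) E
    (fun x => 2 * inner ℝ (ψ x) (ψ' x) + 2 * (W x * inner ℝ (ψ x) (ψ' x)))
    (by linarith) (by linarith) (fun x => by positivity)
    (fun x hx => by
      have := (h1 x hx).norm_sq.add (h2 x hx).norm_sq
      rw [hin] at this
      exact this)
    (fun x hx => by
      have e : 2 * inner ℝ (ψ x) (ψ' x) + 2 * (W x * inner ℝ (ψ x) (ψ' x))
        = (1 + W x) * (2 * inner ℝ (ψ x) (ψ' x)) := by ring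
      rw [e, abs_mul]
      have i1 : |1 + W x| ≤ 1 + M := by
        have := abs_le.1 (hW x hx)
        exact abs_le.2 ⟨by linarith, by linarith⟩
      have i2 : |2 * inner ℝ (ψ x) (ψ' x)| ≤ E x := by
        rw [abs_mul, abs_two]
        have := abs_real_inner_le_norm (ψ x) (ψ' x)
        simp only [hEdef]
        nlinarith [sq_nonneg (‖ψ x‖ - ‖ψ' x‖)]
      exact mul_le_mul i1 i2 (abs_nonneg _) (by linarith))
  have hsub : Set.Icc (a - s/2) (a + s/2) ⊆ Set.Icc (a - 1/2) (a + 1/2) :=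
    Set.Icc_subset_Icc (by linarith) (by linarith)
  have hle : a - s/2 ≤ a + s/2 := by linarith
  have c1 : ContinuousOn ψ (Set.Icc (a - 1/2) (a + 1/2)) :=
    fun x hx => (h1 x hx).continuousAt.continuousWithinAt
  have c2 : ContinuousOn ψ' (Set.Icc (a - 1/2) (a + 1/2)) :=
    fun x hx => (h2 x hx).continuousAt.continuousWithinAt
  have d1 := c1.mono hsub
  have d2 := c2.mono hsub
  have cint : ∀ f : ℝ → ℝ, ContinuousOn f (Set.Icc (a - s/2) (a + s/2)) →
      IntervalIntegrable f MeasureTheory.volume (a - s/2) (a + s/2) := fun f hf =>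
    ContinuousOn.intervalIntegrable (by rwa [Set.uIcc_of_le hle])
  set I : ℝ := ∫ x in (a - 1/2)..(a + 1/2), ‖ψ x‖^2 with hI
  set J : ℝ := ∫ x in (a - s/2)..(a + s/2), ‖ψ x‖^2 with hJ
  have hIE : ∀ x ∈ Set.Icc (a - 1/2) (a + 1/2), Real.exp (-(1+M)) * I ≤ E x := by
    intro x hx
    have : I ≤ ∫ y in (a - 1/2)..(a + 1/2), Real.exp (1+M) * E x := by
      apply intervalIntegral.integral_mono_on (by linarith)
      · exact ContinuousOn.intervalIntegrable (by
          rw [Set.uIcc_of_le (by linarith)]; fun_prop)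
      · simp
      · intro y hy
        refine le_trans ?_ (hgrow x hx y hy)
        simp only [hEdef]
        nlinarith [sq_nonneg ‖ψ' y‖]
    rw [intervalIntegral.integral_const] at this
    have e : (a + 1/2 - (a - 1/2) : ℝ) = 1 := by ring
    rw [e, one_smul] at this
    rw [Real.exp_neg]
    rw [inv_mul_le_iff₀ (Real.exp_pos _)]
    exact this
  set η : ℝ → ℝ := fun x => (s/2)^2 - (x-a)^2 with hη
  have hηc : Continuous η := by simp only [hη]; fun_prop
  have hηd : ∀ x, HasDerivAt (fun x => η x ^2) (2 * η x * (-(2*(x-a)))) x := by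
    intro x
    have := (((((hasDerivAt_id x).sub_const a).pow 2).const_sub ((s/2)^2)).pow 2)
    refine HasDerivAt.congr_deriv this ?_
    simp [hη]
  have hηb : ∀ x ∈ Set.Icc (a - s/2) (a + s/2), η x ^2 ≤ 1 ∧ (2*(x-a))^2 ≤ 1 := by
    intro x hx
    have : (x-a)^2 ≤ (s/2)^2 := by nlinarith [hx.1, hx.2]
    have h4 : (s/2)^2 ≤ 1/4 := by nlinarith
    have h5 := sq_nonneg (x-a)
    constructor
    · simp only [hη]; nlinarith
    · nlinarith
  have hcac : ∫ x in (a - s/2)..(a + s/2), (1/2 * (η x^2 * E x) - (3+M) * ‖ψ x‖^2) ≤ 0 := by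
    have hd : ∀ x ∈ Set.Icc (a - 1/2) (a + 1/2),
        HasDerivAt (fun x => η x ^2 * inner ℝ (ψ x) (ψ' x))
        (2 * η x * (-(2*(x-a))) * inner ℝ (ψ x) (ψ' x)
          + η x^2 * (W x * ‖ψ x‖^2 + ‖ψ' x‖^2)) x := by
      intro x hx
      have := (hηd x).mul ((h1 x hx).inner ℝ (h2 x hx))
      rw [← Complex.real_smul, real_inner_smul_right, real_inner_self_eq_norm_sq,
        real_inner_self_eq_norm_sq] at this
      exact this
    have := intervalIntegral.integral_le_sub_of_hasDeriv_right_of_le hle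
      (fun x hx => (hd x (hsub hx)).continuousAt.continuousWithinAt)
      (fun x hx => (hd x (hsub (Set.Ioo_subset_Icc_self hx))).hasDerivWithinAt)
      (φ := fun x => (1/2 * (η x^2 * E x) - (3+M) * ‖ψ x‖^2))
      (ContinuousOn.integrableOn_Icc (by simp only [hEdef]; fun_prop))
      (by
        intro x hx
        have hx := Set.Ioo_subset_Icc_self hx
        obtain ⟨b1, b2⟩ := hηb x hx
        have hw := (abs_le.1 (hW x (hsub hx))).1
        have hc := abs_real_inner_le_norm (ψ x) (ψ' x)
        simp only [hEdef]
        generalize inner ℝ (ψ x) (ψ' x) = i at *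
        have hA := norm_nonneg (ψ x)
        have hB := norm_nonneg (ψ' x)
        generalize ‖ψ x‖ = A at *
        generalize ‖ψ' x‖ = B at *
        generalize η x = e at *
        have hi : i^2 ≤ A^2*B^2 := by
          have := sq_le_sq' (abs_le.1 hc).1 (abs_le.1 hc).2
          nlinarith
        generalize 2*(x-a) = t at *
        -- cross term
        have h3 : 2 * e * t * i ≤ 1/2 * (e^2 * B^2) + 2 * A^2 := by
          have k1 : (t*i)^2 ≤ 1 * (A^2*B^2) := by
            rw [mul_pow]; exact mul_le_mul b2 hi (sq_nonneg _) zero_le_one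
          have k2 : |t*i| ≤ A*B := abs_le_of_sq_le_sq (by nlinarith) (by positivity)
          have k3 : e * (t*i) ≤ |e| * (A*B) := by
            refine (le_abs_self _).trans ?_
            rw [abs_mul]; gcongr
          have k4 := sq_abs e
          nlinarith [sq_nonneg (|e| * B - 2 * A)]
        have h4 : e^2 * (-M * A^2) ≤ e^2 * (W x * A^2) := by gcongr
        have h5 : e^2 * (M * A^2) ≤ 1 * (M * A^2) := by gcongr
        have h6 : e^2 * A^2 ≤ 1 * A^2 := by gcongr
        nlinarith)
    refine this.trans (le_of_eq ?_)
    simp [hη]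
  have hsplit : ∫ x in (a - s/2)..(a + s/2), (1/2 * (η x^2 * E x) - (3+M) * ‖ψ x‖^2)
      = 1/2 * (∫ x in (a - s/2)..(a + s/2), η x^2 * E x) - (3+M) * J := by
    rw [intervalIntegral.integral_sub, intervalIntegral.integral_const_mul,
      intervalIntegral.integral_const_mul]
    · apply cint; simp only [hEdef]; fun_prop
    · apply cint; fun_prop
  have hlow : m * (Real.exp (-(1+M)) * I) ≤ ∫ x in (a - s/2)..(a + s/2), η x^2 * E x := by
    have hm2 : m = ∫ x in (a - s/2)..(a + s/2), η x^2 := by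
      have := intervalIntegral.integral_comp_sub_right (a := a - s/2) (b := a + s/2)
        (fun t : ℝ => ((s/2)^2 - t^2)^2) a
      simp only [hη]
      rw [this, hm]
      congr 1 <;> ring
    rw [hm2, ← intervalIntegral.integral_mul_const]
    apply intervalIntegral.integral_mono_on hle
    · apply cint; fun_prop
    · apply cint; simp only [hEdef]; fun_prop
    · intro x hx
      exact mul_le_mul_of_nonneg_left (hIE x (hsub hx)) (sq_nonneg _)
  rw [div_mul_eq_mul_div, div_le_iff₀ (by positivity)]
  rw [hsplit] at hcac
  nlinarith
end

section
/- Akcoglu–Krengel superadditive ergodic theorem: Let (Ω, 𝔅, P) be a probability space and (T_k)_{k∈ℤ^d} a family of measure preserving transformations of Ω with T_0 = id and T_{j+k} = T_j ∘ T_k for all j,k ∈ ℤ^d. For integer boxes, i.e. pairs (a,b) ∈ ℤ^d × ℤ^d with a_j < b_j for all j, write Λ(a,b) = {x ∈ ℝ^d : a_j < x_j < b_j for all j} and |Λ(a,b)| = ∏_j (b_j − a_j). Let F assign to each integer box an integrable function F_{(a,b)} ∈ L¹(Ω, P) such that: (1) for every k ∈ ℤ^d and every box, F_{(a,b)} ∘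 T_k = F_{(a+k,b+k)} almost surely; (2) whenever boxes (a¹,b¹),…,(aⁿ,bⁿ) have pairwise disjoint sets Λ(aⁱ,bⁱ) and Λ(a,b) equals the interior of ⋃_{i=1}^n closure(Λ(aⁱ,bⁱ)), then F_{(a,b)} ≥ ∑_{i=1}^n F_{(aⁱ,bⁱ)} almost surely; (3) γ(F) := sup over all integer boxes of |Λ(a,b)|^{−1} · E[F_{(a,b)}] is finite. Then for P-almost every ω ∈ Ω the limit lim_{l→∞} (2l)^{−d} F_{((−l,…,−l),(l,…,l))}(ω) exists in ℝ. -/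
open MeasureTheory Filter Topology

/-- The open box in `ℝ^d` with integer corners `a`, `b`. -/
def intBox (d : ℕ) (a b : Fin d → ℤ) : Set (Fin d → ℝ) :=
  {x | ∀ j, (a j : ℝ) < x j ∧ x j < (b j : ℝ)}

/-- Integer points of the half-open box. -/
noncomputable def cells {d : ℕ} (a b : Fin d → ℤ) : Finset (Fin d → ℤ) :=
  Fintype.piFinset fun j => Finset.Ico (a j) (b j)

theorem mem_cells {d : ℕ} {a b x : Fin d → ℤ} : x ∈ cells a b ↔ ∀ j, a j ≤ x j ∧ x j < b j := by
  simp [cells]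

theorem card_cube {d : ℕ} (a : Fin d → ℤ) (n : ℕ) :
    (cells a (a + fun _ => (n : ℤ))).card = n ^ d := by
  simp [cells]

theorem card_ccube {d : ℕ} (k : Fin d → ℤ) (n : ℕ) :
    (cells (k - fun _ => (n : ℤ)) (k + fun _ => (n : ℤ))).card = (2 * n) ^ d := by
  have h := card_cube (k - fun _ => (n : ℤ)) (2 * n)
  rw [← h]; congr 2; funext j; simp; ring

theorem card_ccube0 {d : ℕ} (n : ℕ) :
    (cells (d := d) (fun _ => -(n : ℤ)) (fun _ => (n : ℤ))).card = (2 * n) ^ d := by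
  have h := card_ccube (d := d) 0 n
  rw [← h]; congr 2 <;> (funext j; simp)

/-- Combinatorial superadditive process. -/
structure SA {d : ℕ} {Ω : Type*} [MeasurableSpace Ω] (P : Measure Ω)
    (T : (Fin d → ℤ) → Ω → Ω) (F : (Fin d → ℤ) → (Fin d → ℤ) → Ω → ℝ) : Prop where
  add : ∀ j k : Fin d → ℤ, T (j + k) = T j ∘ T k
  mp : ∀ k : Fin d → ℤ, MeasurePreserving (T k) P P
  int : ∀ a b : Fin d → ℤ, (∀ j, a j < b j) → Integrable (F a b) P
  equiv : ∀ (k a b : Fin d → ℤ), (∀ j, a j < b j) →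
      ∀ᵐ ω ∂P, F a b (T k ω) = F (a + k) (b + k) ω
  super : ∀ (s : Finset ((Fin d → ℤ) × (Fin d → ℤ))) (A B : Fin d → ℤ),
      (∀ p ∈ s, ∀ j, p.1 j < p.2 j) → (∀ j, A j < B j) →
      (∀ p ∈ s, ∀ q ∈ s, ∀ x, x ∈ cells p.1 p.2 → x ∈ cells q.1 q.2 → p = q) →
      (∀ x, x ∈ cells A B ↔ ∃ p ∈ s, x ∈ cells p.1 p.2) →
      ∀ᵐ ω ∂P, (∑ p ∈ s, F p.1 p.2 ω) ≤ F A B ω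

theorem intBox_eq (d : ℕ) (a b : Fin d → ℤ) :
    intBox d a b = Set.pi Set.univ (fun j => Set.Ioo (a j : ℝ) (b j : ℝ)) := by
  ext x; simp [intBox]

theorem closure_intBox {d : ℕ} {a b : Fin d → ℤ} (h : ∀ j, a j < b j) :
    closure (intBox d a b) = Set.pi Set.univ (fun j => Set.Icc (a j : ℝ) (b j : ℝ)) := by
  rw [intBox_eq, closure_pi_set]
  congr 1; funext j
  exact closure_Ioo (by exact_mod_cast (h j).ne)

theorem SA.of_frozen {d : ℕ} {Ω : Type*} [MeasurableSpace Ω] (P : Measure Ω)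
    (T : (Fin d → ℤ) → Ω → Ω)
    (hTadd : ∀ j k : Fin d → ℤ, T (j + k) = T j ∘ T k)
    (hTmp : ∀ k : Fin d → ℤ, MeasurePreserving (T k) P P)
    (F : (Fin d → ℤ) → (Fin d → ℤ) → Ω → ℝ)
    (hint : ∀ a b : Fin d → ℤ, (∀ j, a j < b j) → Integrable (F a b) P)
    (hequiv : ∀ (k a b : Fin d → ℤ), (∀ j, a j < b j) →
      ∀ᵐ ω ∂P, F a b (T k ω) = F (a + k) (b + k) ω)
    (hsuper : ∀ (n : ℕ) (a b : Fin n → Fin d → ℤ) (A B : Fin d → ℤ),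
      (∀ i j, a i j < b i j) → (∀ j, A j < B j) →
      Pairwise (Function.onFun Disjoint (fun i => intBox d (a i) (b i))) →
      intBox d A B = interior (⋃ i, closure (intBox d (a i) (b i))) →
      ∀ᵐ ω ∂P, (∑ i, F (a i) (b i) ω) ≤ F A B ω) : SA P T F := by
  refine ⟨hTadd, hTmp, hint, hequiv, ?_⟩
  intro s A B hs hAB hdis hun
  let e := s.equivFin
  have key := hsuper s.card (fun i => (e.symm i).1.1) (fun i => (e.symm i).1.2) A B
    (fun i j => hs _ (e.symm i).2 j) hAB ?_ ?_
  · filter_upwards [key] with ω hω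
    refine le_trans (le_of_eq ?_) hω
    rw [← Finset.sum_coe_sort s (fun p => F p.1 p.2 ω)]
    exact (Equiv.sum_comp e.symm (fun p : s => F p.1.1 p.1.2 ω)).symm
  · intro i i' hii
    rw [Function.onFun, Set.disjoint_left]
    intro x hx hx'
    apply hii
    apply e.symm.injective
    apply Subtype.ext
    refine hdis _ (e.symm i).2 _ (e.symm i').2 (fun j => ⌊x j⌋) ?_ ?_
    · rw [mem_cells]; intro j
      exact ⟨Int.le_floor.2 (hx j).1.le, Int.floor_lt.2 (hx j).2⟩
    · rw [mem_cells]; intro j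
      exact ⟨Int.le_floor.2 (hx' j).1.le, Int.floor_lt.2 (hx' j).2⟩
  · have : (⋃ i, closure (intBox d ((e.symm i).1.1) ((e.symm i).1.2)))
        = Set.pi Set.univ (fun j => Set.Icc (A j : ℝ) (B j : ℝ)) := by
      ext x
      simp only [Set.mem_iUnion]
      constructor
      · rintro ⟨i, hi⟩
        rw [closure_intBox (hs _ (e.symm i).2)] at hi
        have h1 : (e.symm i).1.1 ∈ cells A B := (hun _).2 ⟨_, (e.symm i).2, by
          rw [mem_cells]; intro j; exact ⟨le_rfl, hs _ (e.symm i).2 j⟩⟩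
        have h2 : (e.symm i).1.2 - 1 ∈ cells A B := (hun _).2 ⟨_, (e.symm i).2, by
          rw [mem_cells]; intro j; have := hs _ (e.symm i).2 j; simp; omega⟩
        rw [mem_cells] at h1 h2
        intro j _
        have h3 := hi j trivial
        have h4 : A j ≤ (e.symm i).1.1 j := (h1 j).1
        have h5 : (e.symm i).1.2 j ≤ B j := by have := (h2 j).2; simp at this; omega
        have h4' : (A j : ℝ) ≤ ((e.symm i).1.1 j : ℝ) := by exact_mod_cast h4
        have h5' : ((e.symm i).1.2 j : ℝ) ≤ B j := by exact_mod_cast h5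
        exact ⟨h4'.trans h3.1, h3.2.trans h5'⟩
      · intro hx
        have hk : (fun j => min ⌊x j⌋ (B j - 1)) ∈ cells A B := by
          rw [mem_cells]; intro j
          have h1 : A j ≤ ⌊x j⌋ := Int.le_floor.2 (hx j trivial).1
          have := hAB j
          simp only [le_min_iff, min_lt_iff]; omega
        obtain ⟨p, hp, hpk⟩ := (hun _).1 hk
        refine ⟨e ⟨p, hp⟩, ?_⟩
        simp only [Equiv.symm_apply_apply]
        rw [closure_intBox (hs _ hp)]
        rw [mem_cells] at hpk
        intro j _
        obtain ⟨h1, h2⟩ := hpk j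
        have hx1 := hx j trivial
        constructor
        · have : p.1 j ≤ ⌊x j⌋ := h1.trans (min_le_left _ _)
          exact Int.le_floor.1 this
        · rcases min_lt_iff.1 h2 with h | h
          · exact (Int.floor_lt.1 h).le
          · have : B j ≤ p.2 j := by omega
            have : (B j : ℝ) ≤ p.2 j := by exact_mod_cast this
            exact hx1.2.trans this
    rw [this, interior_pi_set Set.finite_univ, intBox_eq]
    simp

section
variable {d : ℕ} {Ω : Type*} [MeasurableSpace Ω] {P : Measure Ω}
    {T : (Fin d → ℤ) → Ω → Ω} {F : (Fin d → ℤ) → (Fin d → ℤ) → Ω → ℝ}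

theorem cells_unit {k x : Fin d → ℤ} : x ∈ cells k (k + 1) ↔ x = k := by
  rw [mem_cells]
  constructor
  · intro h; funext j; have := h j; simp at this; omega
  · rintro rfl j; simp

theorem SA.sub (h : SA P T F) (hnn : ∀ a b : Fin d → ℤ, (∀ j, a j < b j) → ∀ᵐ ω ∂P, 0 ≤ F a b ω)
    (s : Finset ((Fin d → ℤ) × (Fin d → ℤ))) (A B : Fin d → ℤ)
    (hs : ∀ p ∈ s, ∀ j, p.1 j < p.2 j) (hAB : ∀ j, A j < B j)
    (hdis : ∀ p ∈ s, ∀ q ∈ s, ∀ x, x ∈ cells p.1 p.2 → x ∈ cells q.1 q.2 → p = q)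
    (hun : ∀ p ∈ s, cells p.1 p.2 ⊆ cells A B) :
    ∀ᵐ ω ∂P, (∑ p ∈ s, F p.1 p.2 ω) ≤ F A B ω := by
  classical
  let r : Finset ((Fin d → ℤ) × (Fin d → ℤ)) :=
    ((cells A B).filter (fun x => ∀ p ∈ s, x ∉ cells p.1 p.2)).image (fun k => (k, k + 1))
  have hr : ∀ p ∈ r, ∃ k, p = (k, k + 1) ∧ k ∈ cells A B ∧ ∀ q ∈ s, k ∉ cells q.1 q.2 := by
    intro p hp
    simp only [r, Finset.mem_image, Finset.mem_filter] at hp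
    obtain ⟨k, hk, rfl⟩ := hp
    exact ⟨k, rfl, hk⟩
  have hpos : ∀ p ∈ s ∪ r, ∀ j, p.1 j < p.2 j := by
    intro p hp
    rcases Finset.mem_union.1 hp with hp | hp
    · exact hs p hp
    · obtain ⟨k, rfl, _⟩ := hr p hp
      intro j; simp
  have key := h.super (s ∪ r) A B hpos hAB ?_ ?_
  · have hall : ∀ᵐ ω ∂P, ∀ p ∈ s ∪ r, 0 ≤ F p.1 p.2 ω := by
      rw [Finset.eventually_all]
      intro p hp
      exact hnn _ _ (hpos p hp)
    filter_upwards [key, hall] with ω h1 h2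
    refine le_trans ?_ h1
    exact Finset.sum_le_sum_of_subset_of_nonneg Finset.subset_union_left
      (fun p hp _ => h2 p hp)
  · intro p hp q hq x hxp hxq
    rcases Finset.mem_union.1 hp with hp | hp <;> rcases Finset.mem_union.1 hq with hq | hq
    · exact hdis p hp q hq x hxp hxq
    · obtain ⟨k, rfl, _, hk⟩ := hr q hq
      rw [cells_unit] at hxq; subst hxq
      exact absurd hxp (hk p hp)
    · obtain ⟨k, rfl, _, hk⟩ := hr p hp
      rw [cells_unit] at hxp; subst hxp
      exact absurd hxq (hk q hq)
    · obtain ⟨k, rfl, _, hk⟩ := hr p hp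
      obtain ⟨k', rfl, _, hk'⟩ := hr q hq
      rw [cells_unit] at hxp hxq; subst hxp; subst hxq; rfl
  · intro x
    constructor
    · intro hx
      by_cases hc : ∃ p ∈ s, x ∈ cells p.1 p.2
      · obtain ⟨p, hp, hx⟩ := hc
        exact ⟨p, Finset.mem_union_left _ hp, hx⟩
      · push Not at hc
        refine ⟨(x, x + 1), Finset.mem_union_right _ ?_, cells_unit.2 rfl⟩
        exact Finset.mem_image.2 ⟨x, Finset.mem_filter.2 ⟨hx, hc⟩, rfl⟩
    · rintro ⟨p, hp, hx⟩
      rcases Finset.mem_union.1 hp with hp | hp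
      · exact hun p hp hx
      · obtain ⟨k, rfl, hk, _⟩ := hr p hp
        rw [cells_unit] at hx; subst hx; exact hk

theorem SA.integral_shift (h : SA P T F) (k a b : Fin d → ℤ) (hab : ∀ j, a j < b j) :
    ∫ ω, F (a + k) (b + k) ω ∂P = ∫ ω, F a b ω ∂P := by
  rw [← integral_congr_ae (h.equiv k a b hab)]
  have hm := (h.int a b hab).1
  have h1 := integral_map (h.mp k).aemeasurable (f := F a b) (by rw [(h.mp k).map_eq]; exact hm)
  rw [(h.mp k).map_eq] at h1
  exact h1.symm

/-- Combinatorial Vitali covering. -/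
theorem vitali_cells (t : Finset (Fin d → ℤ)) (r : (Fin d → ℤ) → ℕ) (hr : ∀ k ∈ t, 1 ≤ r k) :
    ∃ u ⊆ t, (∀ k ∈ u, ∀ k' ∈ u, ∀ x, x ∈ cells (k - fun _ => (r k : ℤ)) (k + fun _ => (r k : ℤ)) →
      x ∈ cells (k' - fun _ => (r k' : ℤ)) (k' + fun _ => (r k' : ℤ)) → k = k') ∧
      t.card ≤ ∑ k ∈ u, 3 ^ d * (2 * r k) ^ d := by
  classical
  obtain ⟨u, hut, hdis, hcov⟩ := Vitali.exists_disjoint_subfamily_covering_enlargement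
    (fun k => (cells (k - fun _ => (r k : ℤ)) (k + fun _ => (r k : ℤ)) : Set (Fin d → ℤ)))
    (t : Set (Fin d → ℤ)) (fun k => (r k : ℝ)) 2 one_lt_two (fun _ _ => by positivity)
    (∑ k ∈ t, (r k : ℝ)) (fun a ha => Finset.single_le_sum (f := fun k => (r k : ℝ))
      (fun _ _ => by positivity) ha)
    (fun a ha => ⟨a, by
      rw [Finset.mem_coe, mem_cells]; intro j; have := hr a ha; simp; omega⟩)
  have hfin : u.Finite := t.finite_toSet.subset hut
  refine ⟨hfin.toFinset, by simpa [Set.Finite.toFinset_subset] using hut, ?_, ?_⟩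
  · intro k hk k' hk' x hx hx'
    by_contra hne
    have := hdis (hfin.mem_toFinset.1 hk) (hfin.mem_toFinset.1 hk') hne
    exact Set.disjoint_left.1 this hx hx'
  · have hsub : t ⊆ hfin.toFinset.biUnion (fun k => cells (k - fun _ => ((3 * r k : ℕ) : ℤ))
        (k + fun _ => ((3 * r k : ℕ) : ℤ))) := by
      intro a ha
      obtain ⟨b, hb, ⟨x, hxa, hxb⟩, hle⟩ := hcov a ha
      refine Finset.mem_biUnion.2 ⟨b, hfin.mem_toFinset.2 hb, ?_⟩
      rw [Finset.mem_coe, mem_cells] at hxa hxb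
      rw [mem_cells]
      intro j
      have h1 := hxa j
      have h2 := hxb j
      have h3 : r a ≤ 2 * r b := by exact_mod_cast hle
      simp at h1 h2 ⊢
      omega
    refine (Finset.card_le_card hsub).trans (Finset.card_biUnion_le.trans ?_)
    refine Finset.sum_le_sum fun k _ => ?_
    rw [card_ccube, ← mul_pow]
    apply le_of_eq; ring

end
section
variable {d : ℕ} {Ω : Type*} [MeasurableSpace Ω] {P : Measure Ω}
    {T : (Fin d → ℤ) → Ω → Ω} {F : (Fin d → ℤ) → (Fin d → ℤ) → Ω → ℝ}

theorem SA.maximal_aux [IsProbabilityMeasure P] (h : SA P T F)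
    (hnn : ∀ a b : Fin d → ℤ, (∀ j, a j < b j) → ∀ᵐ ω ∂P, 0 ≤ F a b ω)
    (γ : ℝ) (hγ : ∀ (a : Fin d → ℤ) (n : ℕ), 0 < n →
      ∫ ω, F a (a + fun _ => (n : ℤ)) ω ∂P ≤ γ * (n : ℝ) ^ d)
    (α : ℝ) (hα : 0 < α) (L N : ℕ) (hN : 0 < N) :
    (N : ℝ) ^ d * P.real {ω | ∃ l : ℕ, 1 ≤ l ∧ l ≤ L ∧
        α * (2 * (l : ℝ)) ^ d < F (fun _ => -(l : ℤ)) (fun _ => (l : ℤ)) ω} ≤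
      3 ^ d / α * (γ * ((N + 2 * L : ℕ) : ℝ) ^ d) := by
  classical
  set E := {ω | ∃ l : ℕ, 1 ≤ l ∧ l ≤ L ∧
        α * (2 * (l : ℝ)) ^ d < F (fun _ => -(l : ℤ)) (fun _ => (l : ℤ)) ω} with hE
  have hEm : NullMeasurableSet E P := by
    have : E = ⋃ l : ℕ, ⋃ (_ : 1 ≤ l), ⋃ (_ : l ≤ L),
        {ω | α * (2 * (l : ℝ)) ^ d < F (fun _ => -(l : ℤ)) (fun _ => (l : ℤ)) ω} := by
      ext ω; simp [hE]; exact exists_congr fun l => and_left_comm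
    rw [this]
    refine NullMeasurableSet.iUnion fun l => NullMeasurableSet.iUnion fun hl =>
      NullMeasurableSet.iUnion fun _ => ?_
    exact nullMeasurableSet_lt aemeasurable_const
      (h.int _ _ (fun j => by omega)).1.aemeasurable
  have hEk : ∀ k, NullMeasurableSet (T k ⁻¹' E) P := fun k =>
    hEm.preimage (h.mp k).quasiMeasurePreserving
  set A : Fin d → ℤ := fun _ => -(L : ℤ) with hA
  set B : Fin d → ℤ := A + fun _ => ((N + 2 * L : ℕ) : ℤ) with hB
  have hAB : ∀ j, A j < B j := fun j => by simp [hA, hB]; omega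
  have heq : ∀ᵐ ω ∂P, ∀ (k : Fin d → ℤ) (l : ℕ), 1 ≤ l →
      F (fun _ => -(l : ℤ)) (fun _ => (l : ℤ)) (T k ω) =
        F (k - fun _ => (l : ℤ)) (k + fun _ => (l : ℤ)) ω := by
    rw [ae_all_iff]; intro k
    rw [ae_all_iff]; intro l
    by_cases hl : 1 ≤ l
    · filter_upwards [h.equiv k (fun _ => -(l : ℤ)) (fun _ => (l : ℤ)) (fun j => by omega)] with ω hω _
      rw [hω]; congr 1
      · funext j; simp; ring
      · exact add_comm _ _
    · exact Eventually.of_forall fun ω hl' => absurd hl' hl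
  have hsub : ∀ᵐ ω ∂P, ∀ s : Finset ((Fin d → ℤ) × (Fin d → ℤ)),
      (∀ p ∈ s, ∀ j, p.1 j < p.2 j) →
      (∀ p ∈ s, ∀ q ∈ s, ∀ x, x ∈ cells p.1 p.2 → x ∈ cells q.1 q.2 → p = q) →
      (∀ p ∈ s, cells p.1 p.2 ⊆ cells A B) → (∑ p ∈ s, F p.1 p.2 ω) ≤ F A B ω := by
    rw [ae_all_iff]; intro s
    by_cases h1 : (∀ p ∈ s, ∀ j, p.1 j < p.2 j) ∧
      (∀ p ∈ s, ∀ q ∈ s, ∀ x, x ∈ cells p.1 p.2 → x ∈ cells q.1 q.2 → p = q) ∧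
      (∀ p ∈ s, cells p.1 p.2 ⊆ cells A B)
    · filter_upwards [h.sub hnn s A B h1.1 hAB h1.2.1 h1.2.2] with ω hω _ _ _ using hω
    · exact Eventually.of_forall fun ω a b c => absurd ⟨a, b, c⟩ h1
  have hpt : ∀ᵐ ω ∂P, (∑ k ∈ cells (0 : Fin d → ℤ) (0 + fun _ => (N : ℤ)),
      (T k ⁻¹' E).indicator (fun _ => (1 : ℝ)) ω) ≤ 3 ^ d / α * F A B ω := by
    filter_upwards [heq, hsub] with ω h1 h2
    set t := (cells (0 : Fin d → ℤ) (0 + fun _ => (N : ℤ))).filter (fun k => T k ω ∈ E) with ht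
    have hcard : (∑ k ∈ cells (0 : Fin d → ℤ) (0 + fun _ => (N : ℤ)),
      (T k ⁻¹' E).indicator (fun _ => (1 : ℝ)) ω) = (t.card : ℝ) := by
      rw [ht, Finset.card_filter]
      push_cast
      refine Finset.sum_congr rfl fun k _ => ?_
      simp [Set.indicator_apply]
    rw [hcard]
    have hex : ∀ k : Fin d → ℤ, ∃ l : ℕ, k ∈ t → 1 ≤ l ∧ l ≤ L ∧
        α * (2 * (l : ℝ)) ^ d < F (k - fun _ => (l : ℤ)) (k + fun _ => (l : ℤ)) ω := by
      intro k
      by_cases hk : k ∈ t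
      · obtain ⟨l, a, b, c⟩ := (Finset.mem_filter.1 hk).2
        exact ⟨l, fun _ => ⟨a, b, by rw [← h1 k l a]; exact c⟩⟩
      · exact ⟨0, fun hk' => absurd hk' hk⟩
    choose r hr using hex
    obtain ⟨u, hut, hdis, hc⟩ := vitali_cells t r (fun k hk => (hr k hk).1)
    set φ : (Fin d → ℤ) → (Fin d → ℤ) × (Fin d → ℤ) :=
      fun k => (k - fun _ => (r k : ℤ), k + fun _ => (r k : ℤ)) with hφ
    have hmem : ∀ k ∈ u, k ∈ cells (φ k).1 (φ k).2 := by
      intro k hk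
      rw [mem_cells]; intro j
      have := (hr k (hut hk)).1
      simp [hφ]; omega
    have hinj : Set.InjOn φ u := by
      intro k hk k' hk' hkk
      exact hdis k hk k' hk' k (hmem k hk) (by have := hmem k hk; rw [hkk] at this; exact this)
    have h3 := h2 (u.image φ) ?_ ?_ ?_
    · rw [Finset.sum_image hinj] at h3
      have h4 : (t.card : ℝ) ≤ ∑ k ∈ u, 3 ^ d * (2 * (r k : ℝ)) ^ d := by exact_mod_cast hc
      have h5 : α * (t.card : ℝ) ≤ 3 ^ d * F A B ω := by
        calc α * (t.card : ℝ) ≤ α * ∑ k ∈ u, 3 ^ d * (2 * (r k : ℝ)) ^ d := by gcongr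
          _ = 3 ^ d * ∑ k ∈ u, α * (2 * (r k : ℝ)) ^ d := by
            rw [Finset.mul_sum, Finset.mul_sum]
            exact Finset.sum_congr rfl fun k _ => by ring
          _ ≤ 3 ^ d * ∑ k ∈ u, F (φ k).1 (φ k).2 ω := by
            gcongr with k hk
            exact (hr k (hut hk)).2.2.le
          _ ≤ _ := by gcongr
      rw [div_mul_eq_mul_div, le_div_iff₀ hα]; linarith
    · intro p hp j
      obtain ⟨k, hk, rfl⟩ := Finset.mem_image.1 hp
      have := (hr k (hut hk)).1
      simp [hφ]; omega
    · intro p hp q hq x hxp hxq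
      obtain ⟨k, hk, rfl⟩ := Finset.mem_image.1 hp
      obtain ⟨k', hk', rfl⟩ := Finset.mem_image.1 hq
      rw [hdis k hk k' hk' x hxp hxq]
    · intro p hp x hx
      obtain ⟨k, hk, rfl⟩ := Finset.mem_image.1 hp
      have h6 := (hr k (hut hk)).2.1
      have h7 := (Finset.mem_filter.1 (hut hk)).1
      rw [mem_cells] at h7 hx ⊢
      intro j
      have := h7 j
      have := hx j
      simp [hφ, hA, hB] at *
      omega
  have hind : ∀ k, Integrable ((T k ⁻¹' E).indicator (fun _ => (1 : ℝ))) P := fun k =>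
    (integrable_const (1 : ℝ)).indicator₀ (hEk k)
  have hI := integral_mono_ae (integrable_finsetSum _ fun k _ => hind k)
    ((h.int A B hAB).const_mul (3 ^ d / α)) hpt
  rw [integral_finsetSum _ (fun k _ => hind k), integral_const_mul] at hI
  have hterm : ∀ k, ∫ ω, (T k ⁻¹' E).indicator (fun _ => (1 : ℝ)) ω ∂P = P.real E := by
    intro k
    rw [integral_indicator₀ (hEk k)]
    simp [Measure.real, (h.mp k).measure_preimage hEm]
  simp only [hterm, Finset.sum_const, card_cube, nsmul_eq_mul] at hI
  push_cast at hI
  refine hI.trans ?_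
  gcongr
  exact hγ A (N + 2 * L) (by omega)

theorem SA.maximal [IsProbabilityMeasure P] (h : SA P T F)
    (hnn : ∀ a b : Fin d → ℤ, (∀ j, a j < b j) → ∀ᵐ ω ∂P, 0 ≤ F a b ω)
    (γ : ℝ) (hγ : ∀ (a : Fin d → ℤ) (n : ℕ), 0 < n →
      ∫ ω, F a (a + fun _ => (n : ℤ)) ω ∂P ≤ γ * (n : ℝ) ^ d)
    (α : ℝ) (hα : 0 < α) :
    P {ω | ∃ l : ℕ, 1 ≤ l ∧
        α * (2 * (l : ℝ)) ^ d < F (fun _ => -(l : ℤ)) (fun _ => (l : ℤ)) ω} ≤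
      ENNReal.ofReal (3 ^ d / α * γ) := by
  set E : ℕ → Set Ω := fun L => {ω | ∃ l : ℕ, 1 ≤ l ∧ l ≤ L ∧
        α * (2 * (l : ℝ)) ^ d < F (fun _ => -(l : ℤ)) (fun _ => (l : ℤ)) ω} with hE
  have hun : {ω | ∃ l : ℕ, 1 ≤ l ∧
        α * (2 * (l : ℝ)) ^ d < F (fun _ => -(l : ℤ)) (fun _ => (l : ℤ)) ω} = ⋃ L, E L := by
    ext ω
    simp only [hE, Set.mem_ofPred_eq, Set.mem_iUnion]
    exact ⟨fun ⟨l, a, b⟩ => ⟨l, l, a, le_rfl, b⟩, fun ⟨_, l, a, _, b⟩ => ⟨l, a, b⟩⟩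
  have hmono : Monotone E := by
    rintro L L' hLL ω ⟨l, a, b, c⟩
    exact ⟨l, a, b.trans hLL, c⟩
  rw [hun, hmono.measure_iUnion]
  refine iSup_le fun L => ?_
  rw [← ENNReal.ofReal_toReal (measure_ne_top P (E L))]
  apply ENNReal.ofReal_le_ofReal
  change P.real (E L) ≤ _
  have hlim : Tendsto (fun N : ℕ => 3 ^ d / α * γ * (1 + 2 * (L : ℝ) / (N : ℝ)) ^ d) atTop
      (𝓝 (3 ^ d / α * γ * (1 + 0) ^ d)) :=
    ((tendsto_const_nhds.add (tendsto_const_div_atTop_nhds_zero_nat _)).pow d).const_mul _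
  simp only [add_zero, one_pow, mul_one] at hlim
  refine ge_of_tendsto hlim ?_
  filter_upwards [eventually_gt_atTop 0] with N hN
  have h1 := h.maximal_aux hnn γ hγ α hα L N hN
  have hN' : (0 : ℝ) < N := by exact_mod_cast hN
  have h2 : (1 + 2 * (L : ℝ) / (N : ℝ)) ^ d = ((N + 2 * L : ℕ) : ℝ) ^ d / (N : ℝ) ^ d := by
    rw [← div_pow]; congr 1; push_cast; field_simp
  rw [h2, mul_div_assoc', le_div_iff₀ (by positivity)]
  calc _ = (N : ℝ) ^ d * P.real (E L) := mul_comm _ _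
    _ ≤ _ := h1
    _ = _ := by ring
end
section
variable {d : ℕ} {Ω : Type*} [MeasurableSpace Ω] {P : Measure Ω}
    {T : (Fin d → ℤ) → Ω → Ω} {F : (Fin d → ℤ) → (Fin d → ℤ) → Ω → ℝ}

theorem ae_converge_of_osc (X : ℕ → Ω → ℝ)
    (h : ∀ α : ℝ, 0 < α → ∀ ε : ℝ, 0 < ε →
      P {ω | ¬ ∃ N : ℕ, ∀ n, N ≤ n → ∀ m, N ≤ m → |X n ω - X m ω| ≤ α} ≤ ENNReal.ofReal ε) :
    ∀ᵐ ω ∂P, ∃ L : ℝ, Tendsto (fun n => X n ω) atTop (𝓝 L) := by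
  have h1 : ∀ α : ℝ, 0 < α →
      ∀ᵐ ω ∂P, ∃ N : ℕ, ∀ n, N ≤ n → ∀ m, N ≤ m → |X n ω - X m ω| ≤ α := by
    intro α hα
    rw [ae_iff, ← nonpos_iff_eq_zero]
    refine ENNReal.le_of_forall_pos_le_add fun ε hε _ => ?_
    refine (h α hα ε (by exact_mod_cast hε)).trans ?_
    simp
  have h2 : ∀ᵐ ω ∂P, ∀ i : ℕ, ∃ N : ℕ, ∀ n, N ≤ n → ∀ m, N ≤ m →
      |X n ω - X m ω| ≤ 1 / ((i : ℝ) + 1) :=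
    ae_all_iff.2 fun i => h1 _ (by positivity)
  filter_upwards [h2] with ω hω
  apply cauchySeq_tendsto_of_complete
  rw [Metric.cauchySeq_iff]
  intro ε hε
  obtain ⟨i, hi⟩ := exists_nat_one_div_lt hε
  obtain ⟨N, hN⟩ := hω i
  exact ⟨N, fun n hn m hm => by rw [Real.dist_eq]; exact (hN n hn m hm).trans_lt hi⟩

/-- Additive process. -/
noncomputable def addProc (T : (Fin d → ℤ) → Ω → Ω) (f : Ω → ℝ) (a b : Fin d → ℤ) (ω : Ω) : ℝ :=
  ∑ k ∈ cells a b, f (T k ω)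

/-- Cube averages. -/
noncomputable def cavg (T : (Fin d → ℤ) → Ω → Ω) (f : Ω → ℝ) (l : ℕ) (ω : Ω) : ℝ :=
  addProc T f (fun _ => -(l : ℤ)) (fun _ => (l : ℤ)) ω / (2 * (l : ℝ)) ^ d

theorem sum_cells_shift (a b j : Fin d → ℤ) (g : (Fin d → ℤ) → ℝ) :
    ∑ k ∈ cells a b, g (k + j) = ∑ k ∈ cells (a + j) (b + j), g k := by
  refine Finset.sum_bij' (fun k _ => k + j) (fun k _ => k - j) ?_ ?_ ?_ ?_ ?_
  · intro k hk; rw [mem_cells] at *; intro i; have := hk i; simp; omega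
  · intro k hk; rw [mem_cells] at *; intro i; have := hk i; simp at *; omega
  · intro k _; simp
  · intro k _; simp
  · intro k _; rfl

theorem integrable_T (hmp : ∀ k : Fin d → ℤ, MeasurePreserving (T k) P P) {f : Ω → ℝ}
    (hf : Integrable f P) (k : Fin d → ℤ) : Integrable (fun ω => f (T k ω)) P :=
  ((hmp k).integrable_comp hf.1).2 hf

theorem integral_T (hmp : ∀ k : Fin d → ℤ, MeasurePreserving (T k) P P) {f : Ω → ℝ}
    (hf : Integrable f P) (k : Fin d → ℤ) : ∫ ω, f (T k ω) ∂P = ∫ ω, f ω ∂P := by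
  have h1 := integral_map (hmp k).aemeasurable (f := f) (by rw [(hmp k).map_eq]; exact hf.1)
  rw [(hmp k).map_eq] at h1
  exact h1.symm

theorem SA.ofAdd (hadd : ∀ j k : Fin d → ℤ, T (j + k) = T j ∘ T k)
    (hmp : ∀ k : Fin d → ℤ, MeasurePreserving (T k) P P) {f : Ω → ℝ} (hf : Integrable f P) :
    SA P T (addProc T f) := by
  classical
  refine ⟨hadd, hmp, ?_, ?_, ?_⟩
  · intro a b _
    exact integrable_finsetSum _ fun k _ => integrable_T hmp hf k
  · intro k a b _
    refine Eventually.of_forall fun ω => ?_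
    simp only [addProc]
    rw [← sum_cells_shift a b k (fun k => f (T k ω))]
    refine Finset.sum_congr rfl fun i _ => ?_
    rw [hadd]; rfl
  · intro s A B _ _ hdis hun
    refine Eventually.of_forall fun ω => le_of_eq ?_
    simp only [addProc]
    have : cells A B = s.biUnion (fun p => cells p.1 p.2) := by
      ext x; rw [hun]; simp
    rw [this, Finset.sum_biUnion]
    intro p hp q hq hpq
    rw [Function.onFun, Finset.disjoint_left]
    intro x hx hx'
    exact hpq (hdis p hp q hq x hx hx')

theorem cavg_closure [IsProbabilityMeasure P] (hadd : ∀ j k : Fin d → ℤ, T (j + k) = T j ∘ T k)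
    (hmp : ∀ k : Fin d → ℤ, MeasurePreserving (T k) P P) {f : Ω → ℝ} (hf : Integrable f P)
    (happ : ∀ ε : ℝ, 0 < ε → ∃ g : Ω → ℝ, Integrable g P ∧
      (∀ᵐ ω ∂P, ∃ L : ℝ, Tendsto (fun l => cavg T g l ω) atTop (𝓝 L)) ∧
      ∫ ω, |f ω - g ω| ∂P ≤ ε) :
    ∀ᵐ ω ∂P, ∃ L : ℝ, Tendsto (fun l => cavg T f l ω) atTop (𝓝 L) := by
  refine ae_converge_of_osc _ ?_
  intro α hα ε hε
  obtain ⟨g, hg, hgc, hfg⟩ := happ (ε * (α / 4) / 3 ^ d) (by positivity)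
  have hh : Integrable (fun ω => |f ω - g ω|) P := (hf.sub hg).abs
  have hmax := (SA.ofAdd hadd hmp hh).maximal
    (fun a b _ => Eventually.of_forall fun ω => Finset.sum_nonneg fun k _ => abs_nonneg _)
    (∫ ω, |f ω - g ω| ∂P) ?_ (α / 4) (by positivity)
  · refine le_trans ?_ (hmax.trans (ENNReal.ofReal_le_ofReal ?_))
    · apply measure_mono_ae
      filter_upwards [hgc] with ω ⟨L, hL⟩ hω
      by_contra hcon
      apply hω
      have hcon : ∀ l : ℕ, 1 ≤ l → addProc T (fun ω => |f ω - g ω|) (fun _ => -(l : ℤ))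
          (fun _ => (l : ℤ)) ω ≤ α / 4 * (2 * (l : ℝ)) ^ d := by
        intro l hl
        by_contra hlt
        exact hcon ⟨l, hl, not_le.1 hlt⟩
      have hd : ∀ l : ℕ, 1 ≤ l → |cavg T f l ω - cavg T g l ω| ≤ α / 4 := by
        intro l hl
        have hl' : (0 : ℝ) < l := by exact_mod_cast hl
        rw [cavg, cavg, ← sub_div, abs_div, abs_of_pos (by positivity : (0 : ℝ) < (2 * (l : ℝ)) ^ d),
          div_le_iff₀ (by positivity)]
        refine le_trans ?_ (hcon l hl)
        simp only [addProc, ← Finset.sum_sub_distrib]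
        exact Finset.abs_sum_le_sum_abs _ _
      have hev : ∀ᶠ l in atTop, |cavg T g l ω - L| < α / 4 := by
        have := hL.eventually (Metric.ball_mem_nhds L (by positivity : 0 < α / 4))
        simpa [Metric.mem_ball, Real.dist_eq] using this
      obtain ⟨N, hN⟩ := (hev.and (eventually_ge_atTop 1)).exists_forall_of_atTop
      refine ⟨N, fun n hn m hm => ?_⟩
      have a1 := abs_le.1 (hd n (hN n hn).2)
      have a2 := abs_le.1 (hd m (hN m hm).2)
      have a3 := abs_lt.1 (hN n hn).1
      have a4 := abs_lt.1 (hN m hm).1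
      rw [abs_le]; constructor <;> linarith
    · calc 3 ^ d / (α / 4) * ∫ ω, |f ω - g ω| ∂P
          ≤ 3 ^ d / (α / 4) * (ε * (α / 4) / 3 ^ d) := by gcongr
        _ = ε := by field_simp
  · intro a n _
    simp only [addProc]
    rw [integral_finsetSum _ (fun k _ => integrable_T hmp hh k)]
    simp only [integral_T hmp hh]
    rw [Finset.sum_const, card_cube, nsmul_eq_mul]
    push_cast
    exact le_of_eq (mul_comm _ _)

theorem cavg_add (f g : Ω → ℝ) (l : ℕ) (ω : Ω) :
    cavg T (fun ω => f ω + g ω) l ω = cavg T f l ω + cavg T g l ω := by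
  simp only [cavg, addProc, Finset.sum_add_distrib, add_div]

theorem cavg_smul (c : ℝ) (g : Ω → ℝ) (l : ℕ) (ω : Ω) :
    cavg T (fun ω => c * g ω) l ω = c * cavg T g l ω := by
  simp only [cavg, addProc, ← Finset.mul_sum, mul_div_assoc]

theorem cavg_congr (hmp : ∀ k : Fin d → ℤ, MeasurePreserving (T k) P P) {f g : Ω → ℝ}
    (hfg : f =ᵐ[P] g) : ∀ᵐ ω ∂P, ∀ l, cavg T f l ω = cavg T g l ω := by
  have : ∀ᵐ ω ∂P, ∀ k, f (T k ω) = g (T k ω) :=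
    ae_all_iff.2 fun k => (hmp k).quasiMeasurePreserving.ae hfg
  filter_upwards [this] with ω hω l
  simp only [cavg, addProc, hω]

/-- Averages converge a.e. -/
def Conv (P : Measure Ω) (T : (Fin d → ℤ) → Ω → Ω) (f : Ω → ℝ) : Prop :=
  ∀ᵐ ω ∂P, ∃ L : ℝ, Tendsto (fun l => cavg T f l ω) atTop (𝓝 L)

theorem Conv.congr (hmp : ∀ k : Fin d → ℤ, MeasurePreserving (T k) P P) {f g : Ω → ℝ}
    (hf : Conv P T f) (hfg : f =ᵐ[P] g) : Conv P T g := by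
  filter_upwards [hf, cavg_congr hmp hfg] with ω h1 h2
  simpa only [← h2] using h1

theorem Conv.add {f g : Ω → ℝ} (hf : Conv P T f) (hg : Conv P T g) :
    Conv P T (fun ω => f ω + g ω) := by
  filter_upwards [hf, hg] with ω ⟨L, h1⟩ ⟨M, h2⟩
  exact ⟨L + M, by simpa only [cavg_add] using h1.add h2⟩

theorem Conv.smul {f : Ω → ℝ} (c : ℝ) (hf : Conv P T f) :
    Conv P T (fun ω => c * f ω) := by
  filter_upwards [hf] with ω ⟨L, h1⟩
  exact ⟨c * L, by simpa only [cavg_smul] using h1.const_mul c⟩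

theorem Conv.invariant {f : Ω → ℝ} (hf : ∀ k, (fun ω => f (T k ω)) =ᵐ[P] f) : Conv P T f := by
  have : ∀ᵐ ω ∂P, ∀ k, f (T k ω) = f ω := ae_all_iff.2 hf
  filter_upwards [this] with ω hω
  refine ⟨f ω, tendsto_const_nhds.congr' ?_⟩
  filter_upwards [eventually_gt_atTop 0] with l hl
  have hl' : (0 : ℝ) < l := by exact_mod_cast hl
  simp only [cavg, addProc, hω, Finset.sum_const, card_ccube0, nsmul_eq_mul]
  push_cast
  field_simp

theorem Conv.cobound (hadd : ∀ j k : Fin d → ℤ, T (j + k) = T j ∘ T k) {f : Ω → ℝ} {C : ℝ}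
    (hC : ∀ ω, |f ω| ≤ C) (j : Fin d → ℤ) : Conv P T (fun ω => f ω - f (T j ω)) := by
  classical
  refine Eventually.of_forall fun ω => ⟨0, ?_⟩
  set J : ℕ := ∑ i, (j i).natAbs with hJ
  have hj : ∀ i, (j i).natAbs ≤ J := fun i =>
    Finset.single_le_sum (f := fun i => (j i).natAbs) (fun _ _ => Nat.zero_le _) (Finset.mem_univ i)
  have hlim : Tendsto (fun l : ℕ => 2 * (C * (1 - (1 - (J : ℝ) / (l : ℝ)) ^ d))) atTop
      (𝓝 (2 * (C * (1 - (1 - 0) ^ d)))) :=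
    ((((tendsto_const_nhds.sub (tendsto_const_div_atTop_nhds_zero_nat _)).pow d).const_sub
      1).const_mul C).const_mul 2
  simp only [sub_zero, one_pow, sub_self, mul_zero] at hlim
  refine squeeze_zero_norm' ?_ hlim
  filter_upwards [eventually_gt_atTop J] with l hl
  have hl' : (0 : ℝ) < l := by exact_mod_cast (Nat.zero_le J).trans_lt hl
  set S := cells (d := d) (fun _ => -(l : ℤ)) (fun _ => (l : ℤ)) with hS
  set S' := cells (d := d) ((fun _ => -(l : ℤ)) + j) ((fun _ => (l : ℤ)) + j) with hS'
  set K := cells (d := d) (fun _ => -((l - J : ℕ) : ℤ)) (fun _ => ((l - J : ℕ) : ℤ)) with hK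
  have hKS : K ⊆ S := by
    intro x hx; rw [mem_cells] at *; intro i; have := hx i; omega
  have hKS' : K ⊆ S' := by
    intro x hx; rw [mem_cells] at *; intro i; have := hx i; have := hj i
    simp only [Pi.add_apply]; omega
  have hcS : S.card = (2 * l) ^ d := card_ccube0 l
  have hcK : K.card = (2 * (l - J)) ^ d := card_ccube0 _
  have hcS' : S'.card = (2 * l) ^ d := by
    rw [← card_ccube j l, hS']; congr 2
    · funext i; simp; ring
    · exact add_comm _ _
  have hsum : addProc T (fun ω => f ω - f (T j ω)) (fun _ => -(l : ℤ)) (fun _ => (l : ℤ)) ω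
      = ∑ k ∈ S \ K, f (T k ω) - ∑ k ∈ S' \ K, f (T k ω) := by
    have h1 : ∑ k ∈ S, f (T j (T k ω)) = ∑ k ∈ S', f (T k ω) := by
      rw [hS', ← sum_cells_shift _ _ j (fun k => f (T k ω))]
      refine Finset.sum_congr rfl fun i _ => ?_
      rw [add_comm, hadd]; rfl
    simp only [addProc, Finset.sum_sub_distrib]
    rw [h1, ← Finset.sum_sdiff hKS, ← Finset.sum_sdiff hKS']
    ring
  have hbd : ∀ R : Finset (Fin d → ℤ), K ⊆ R → R.card = (2 * l) ^ d →
      |∑ k ∈ R \ K, f (T k ω)| ≤ C * ((2 * (l : ℝ)) ^ d - (2 * ((l : ℝ) - J)) ^ d) := by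
    intro R hR hRc
    refine (Finset.abs_sum_le_sum_abs _ _).trans ?_
    refine (Finset.sum_le_card_nsmul _ _ C fun k _ => hC _).trans (le_of_eq ?_)
    have hc : (((R \ K).card : ℕ) : ℝ) = (2 * (l : ℝ)) ^ d - (2 * ((l : ℝ) - J)) ^ d := by
      rw [Finset.card_sdiff_of_subset hR, Nat.cast_sub (Finset.card_le_card hR), hRc, hcK]
      push_cast [Nat.cast_sub hl.le]; rfl
    rw [nsmul_eq_mul, hc, mul_comm]
  have hpos : (0 : ℝ) < (2 * (l : ℝ)) ^ d := by positivity
  rw [Real.norm_eq_abs, cavg, abs_div, abs_of_pos hpos, div_le_iff₀ hpos, hsum]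
  have e : (2 * ((l : ℝ) - J)) ^ d = (1 - (J : ℝ) / l) ^ d * (2 * (l : ℝ)) ^ d := by
    rw [← mul_pow]; congr 1; field_simp
  have b1 := hbd S hKS hcS
  have b2 := hbd S' hKS' hcS'
  rw [e] at b1 b2
  refine (abs_sub _ _).trans ((add_le_add b1 b2).trans (le_of_eq ?_))
  ring

end
section
variable {d : ℕ} {Ω : Type*} [MeasurableSpace Ω] {P : Measure Ω}
    {T : (Fin d → ℤ) → Ω → Ω} {F : (Fin d → ℤ) → (Fin d → ℤ) → Ω → ℝ}

theorem integral_abs_le_of_eLpNorm {h : Ω → ℝ} (hm : AEStronglyMeasurable h P) {ε : ℝ} (hε : 0 ≤ ε)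
    (hh : eLpNorm h 1 P ≤ ENNReal.ofReal ε) : ∫ ω, |h ω| ∂P ≤ ε := by
  have h1 := integral_norm_eq_lintegral_enorm hm
  simp only [Real.norm_eq_abs] at h1
  rw [h1, ← eLpNorm_one_eq_lintegral_enorm]
  exact ENNReal.toReal_le_of_le_ofReal hε hh

theorem exists_simple_approx {f : Ω → ℝ} (hf : Integrable f P) {ε : ℝ} (hε : 0 < ε) :
    ∃ g : SimpleFunc Ω ℝ, Integrable g P ∧ ∫ ω, |f ω - g ω| ∂P ≤ ε := by
  obtain ⟨g, hg, hg'⟩ := (memLp_one_iff_integrable.2 hf).exists_simpleFunc_eLpNorm_sub_lt (by simp)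
    (ε := ENNReal.ofReal ε) (by simpa using hε)
  exact ⟨g, memLp_one_iff_integrable.1 hg', integral_abs_le_of_eLpNorm (hf.1.sub hg'.1) hε.le hg.le⟩

theorem Conv.cobound_int [IsProbabilityMeasure P]
    (hadd : ∀ j k : Fin d → ℤ, T (j + k) = T j ∘ T k)
    (hmp : ∀ k : Fin d → ℤ, MeasurePreserving (T k) P P) {f : Ω → ℝ} (hf : Integrable f P)
    (j : Fin d → ℤ) : Conv P T (fun ω => f ω - f (T j ω)) := by
  refine cavg_closure hadd hmp (hf.sub (integrable_T hmp hf j)) ?_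
  intro ε hε
  obtain ⟨g, hg, hfg⟩ := exists_simple_approx hf (half_pos hε)
  obtain ⟨C, hC⟩ := g.exists_forall_norm_le
  refine ⟨fun ω => g ω - g (T j ω), hg.sub (integrable_T hmp hg j),
    Conv.cobound hadd (C := C) hC j, ?_⟩
  have hh : Integrable (fun ω => |f ω - g ω|) P := (hf.sub hg).abs
  have hh' := integrable_T hmp hh j
  calc ∫ ω, |f ω - f (T j ω) - (g ω - g (T j ω))| ∂P
      ≤ ∫ ω, (|f ω - g ω| + |f (T j ω) - g (T j ω)|) ∂P := by
        refine integral_mono ?_ (hh.add hh') ?_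
        · exact ((hf.sub (integrable_T hmp hf j)).sub (hg.sub (integrable_T hmp hg j))).abs
        · intro ω
          have : f ω - f (T j ω) - (g ω - g (T j ω)) = (f ω - g ω) - (f (T j ω) - g (T j ω)) := by
            ring
          simp only [this]
          exact abs_sub _ _
    _ = ∫ ω, |f ω - g ω| ∂P + ∫ ω, |f ω - g ω| ∂P := by
        rw [integral_add hh hh', integral_T hmp hh j]
    _ ≤ ε := by linarith

theorem Conv.L2 [IsProbabilityMeasure P]
    (hadd : ∀ j k : Fin d → ℤ, T (j + k) = T j ∘ T k)
    (hmp : ∀ k : Fin d → ℤ, MeasurePreserving (T k) P P) (x : Lp ℝ 2 P) : Conv P T x := by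
  have hint : ∀ y : Lp ℝ 2 P, Integrable y P := fun y =>
    (Lp.memLp y).integrable (by norm_num)
  let U : (Fin d → ℤ) → (Lp ℝ 2 P →ₗᵢ[ℝ] Lp ℝ 2 P) := fun k =>
    Lp.compMeasurePreservingₗᵢ ℝ (T k) (hmp k)
  have hU : ∀ k (y : Lp ℝ 2 P), (U k y : Ω → ℝ) =ᵐ[P] fun ω => y (T k ω) := fun k y =>
    Lp.coeFn_compMeasurePreserving y (hmp k)
  let K : Submodule ℝ (Lp ℝ 2 P) :=
    Submodule.span ℝ {z | ∃ k h, z = h - U k h}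
  have hK : ∀ z ∈ K, Conv P T (z : Ω → ℝ) := by
    intro z hz
    induction hz using Submodule.span_induction with
    | mem z hz =>
      obtain ⟨k, h, rfl⟩ := hz
      refine (Conv.cobound_int hadd hmp (hint h) k).congr hmp ?_
      filter_upwards [Lp.coeFn_sub h (U k h), hU k h] with ω h1 h2
      rw [h1, Pi.sub_apply, h2]
    | zero =>
      refine Conv.invariant fun k => ?_
      have h0 := Lp.coeFn_zero ℝ 2 P
      filter_upwards [h0, (hmp k).quasiMeasurePreserving.ae h0] with ω h1 h2
      rw [h1, h2]; rfl
    | add y z _ _ hy hz =>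
      refine (hy.add hz).congr hmp ?_
      filter_upwards [Lp.coeFn_add y z] with ω h1
      rw [h1]; rfl
    | smul c y _ hy =>
      refine (hy.smul c).congr hmp ?_
      filter_upwards [Lp.coeFn_smul c y] with ω h1
      rw [h1]; rfl
  have hK' : ∀ z ∈ K.topologicalClosure, Conv P T (z : Ω → ℝ) := by
    intro z hz
    refine cavg_closure hadd hmp (hint z) ?_
    intro ε hε
    have hz' : z ∈ closure (K : Set (Lp ℝ 2 P)) := hz
    obtain ⟨y, hy, hzy⟩ := Metric.mem_closure_iff.1 hz' ε hε
    refine ⟨y, hint y, hK y hy, ?_⟩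
    refine integral_abs_le_of_eLpNorm (h := fun ω => z ω - y ω) ((hint z).sub (hint y)).1 hε.le ?_
    have hae := Lp.coeFn_sub z y
    have h1 : eLpNorm (fun ω => z ω - y ω) 1 P ≤ eLpNorm (fun ω => z ω - y ω) 2 P :=
      eLpNorm_le_eLpNorm_of_exponent_le (by norm_num) ((hint z).sub (hint y)).1
    have h2 : eLpNorm (fun ω => z ω - y ω) 2 P = eLpNorm (z - y : Lp ℝ 2 P) 2 P :=
      eLpNorm_congr_ae hae.symm
    refine h1.trans ?_
    rw [h2, ← ENNReal.ofReal_toReal (Lp.eLpNorm_ne_top (z - y)), ← Lp.norm_def, ← dist_eq_norm]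
    exact ENNReal.ofReal_le_ofReal hzy.le
  have hKo : ∀ z ∈ K.topologicalClosureᗮ, Conv P T (z : Ω → ℝ) := by
    intro z hz
    refine Conv.invariant fun k => ?_
    have h0 : inner ℝ (z - U k z) z = 0 :=
      hz _ (K.le_topologicalClosure (Submodule.subset_span ⟨k, z, rfl⟩))
    have h1 : U k z = z := by
      have h3 : ‖z - U k z‖ ^ 2 = 0 := by
        have h2 := norm_sub_sq_real z (U k z)
        rw [inner_sub_left, real_inner_self_eq_norm_sq, real_inner_comm] at h0
        rw [h2, (U k).norm_map]; linarith
      have h4 : ‖z - U k z‖ = 0 := by simpa using h3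
      exact (sub_eq_zero.1 (norm_eq_zero.1 h4)).symm
    have h2 := hU k z
    rw [h1] at h2
    exact h2.symm
  obtain ⟨y, hy, z, hz, rfl⟩ := K.topologicalClosure.exists_add_mem_mem_orthogonal x
  refine ((hK' y hy).add (hKo z hz)).congr hmp ?_
  filter_upwards [Lp.coeFn_add y z] with ω h1
  rw [h1]; rfl

/-- Multiparameter pointwise ergodic theorem. -/
theorem Conv.all [IsProbabilityMeasure P]
    (hadd : ∀ j k : Fin d → ℤ, T (j + k) = T j ∘ T k)
    (hmp : ∀ k : Fin d → ℤ, MeasurePreserving (T k) P P) {f : Ω → ℝ} (hf : Integrable f P) :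
    Conv P T f := by
  refine cavg_closure hadd hmp hf ?_
  intro ε hε
  obtain ⟨g, hg, hfg⟩ := exists_simple_approx hf hε
  obtain ⟨C, hC⟩ := g.exists_forall_norm_le
  have h2 : MemLp g 2 P := MemLp.of_bound g.aestronglyMeasurable C (Eventually.of_forall hC)
  exact ⟨g, hg, (Conv.L2 hadd hmp h2.toLp).congr hmp h2.coeFn_toLp, hfg⟩

end
section
variable {d : ℕ} {Ω : Type*} [MeasurableSpace Ω] {P : Measure Ω}
    {T : (Fin d → ℤ) → Ω → Ω} {F : (Fin d → ℤ) → (Fin d → ℤ) → Ω → ℝ}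

/-- Scaled process minus its additive minorant. -/
noncomputable def redProc (F : (Fin d → ℤ) → (Fin d → ℤ) → Ω → ℝ) (m : ℕ) (a b : Fin d → ℤ) (ω : Ω) :
    ℝ := F (m • a) (m • b) ω - ∑ k ∈ cells a b, F (m • k) (m • (k + 1)) ω

theorem mem_cells_smul {m : ℕ} (hm : 0 < m) {a b x : Fin d → ℤ} :
    x ∈ cells (m • a) (m • b) ↔ (fun j => x j / (m : ℤ)) ∈ cells a b := by
  have hm' : (0 : ℤ) < m := by exact_mod_cast hm
  rw [mem_cells, mem_cells]
  refine forall_congr' fun j => ?_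
  rw [Int.le_ediv_iff_mul_le hm', Int.ediv_lt_iff_lt_mul hm']
  simp [mul_comm]

theorem smul_lt {m : ℕ} (hm : 0 < m) {a b : Fin d → ℤ} (h : ∀ j, a j < b j) :
    ∀ j, (m • a) j < (m • b) j := by
  have hm' : (0 : ℤ) < m := by exact_mod_cast hm
  intro j
  simp only [Pi.smul_apply, nsmul_eq_mul]
  exact mul_lt_mul_of_pos_left (h j) hm'

theorem lt_unit (k : Fin d → ℤ) : ∀ j, k j < (k + 1) j := fun j => by simp

theorem smul_inj {m : ℕ} (hm : 0 < m) : Function.Injective (fun a : Fin d → ℤ => m • a) := by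
  intro a b h
  funext j
  have := congrFun h j
  simp only [Pi.smul_apply, nsmul_eq_mul] at this
  exact mul_left_cancel₀ (by exact_mod_cast hm.ne') this

theorem SA.red_nonneg (h : SA P T F) {m : ℕ} (hm : 0 < m) (a b : Fin d → ℤ) (hab : ∀ j, a j < b j) :
    ∀ᵐ ω ∂P, 0 ≤ redProc F m a b ω := by
  classical
  let φ : (Fin d → ℤ) → (Fin d → ℤ) × (Fin d → ℤ) := fun k => (m • k, m • (k + 1))
  have hφ : Function.Injective φ := fun k k' hk => smul_inj hm (congrArg Prod.fst hk)
  have key := h.super ((cells a b).image φ) (m • a) (m • b) ?_ (smul_lt hm hab) ?_ ?_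
  · filter_upwards [key] with ω hω
    rw [Finset.sum_image hφ.injOn] at hω
    simp only [redProc]
    exact sub_nonneg.2 hω
  · intro p hp
    obtain ⟨k, _, rfl⟩ := Finset.mem_image.1 hp
    exact smul_lt hm (lt_unit k)
  · intro p hp q hq x hxp hxq
    obtain ⟨k, _, rfl⟩ := Finset.mem_image.1 hp
    obtain ⟨k', _, rfl⟩ := Finset.mem_image.1 hq
    simp only [φ] at hxp hxq
    rw [mem_cells_smul hm, cells_unit] at hxp hxq
    rw [← hxp, ← hxq]
  · intro x
    rw [mem_cells_smul hm]
    constructor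
    · intro hx
      refine ⟨_, Finset.mem_image_of_mem φ hx, ?_⟩
      simp only [φ]
      rw [mem_cells_smul hm, cells_unit]
    · rintro ⟨p, hp, hx⟩
      obtain ⟨k, hk, rfl⟩ := Finset.mem_image.1 hp
      simp only [φ] at hx
      rw [mem_cells_smul hm, cells_unit] at hx
      rw [hx]; exact hk

theorem SA.toRed (h : SA P T F) {m : ℕ} (hm : 0 < m) :
    SA P (fun k => T (m • k)) (redProc F m) := by
  classical
  refine ⟨fun j k => by rw [smul_add]; exact h.add _ _, fun k => h.mp _, ?_, ?_, ?_⟩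
  · intro a b hab
    exact (h.int _ _ (smul_lt hm hab)).sub
      (integrable_finsetSum _ fun k _ => h.int _ _ (smul_lt hm (lt_unit k)))
  · intro k a b hab
    have h1 : ∀ᵐ ω ∂P, ∀ i : Fin d → ℤ, F (m • i) (m • (i + 1)) (T (m • k) ω)
        = F (m • (i + k)) (m • (i + k + 1)) ω := by
      rw [ae_all_iff]; intro i
      filter_upwards [h.equiv (m • k) _ _ (smul_lt hm (lt_unit i))] with ω hω
      rw [hω, ← smul_add, ← smul_add, add_right_comm]
    filter_upwards [h1, h.equiv (m • k) _ _ (smul_lt hm hab)] with ω h2 h3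
    simp only [redProc, h2, h3]
    rw [sum_cells_shift a b k (fun i => F (m • i) (m • (i + 1)) ω), smul_add, smul_add]
  · intro s A B hs hAB hdis hun
    let φ : (Fin d → ℤ) × (Fin d → ℤ) → (Fin d → ℤ) × (Fin d → ℤ) := fun p => (m • p.1, m • p.2)
    have hφ : Function.Injective φ := fun p q hpq =>
      Prod.ext (smul_inj hm (congrArg Prod.fst hpq)) (smul_inj hm (congrArg Prod.snd hpq))
    have key := h.super (s.image φ) (m • A) (m • B) ?_ (smul_lt hm hAB) ?_ ?_
    · filter_upwards [key] with ω hω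
      rw [Finset.sum_image hφ.injOn] at hω
      have hc : cells A B = s.biUnion (fun p => cells p.1 p.2) := by
        ext x; rw [hun]; simp
      simp only [redProc, Finset.sum_sub_distrib]
      rw [hc, Finset.sum_biUnion]
      · exact sub_le_sub_right hω _
      · intro p hp q hq hpq
        rw [Function.onFun, Finset.disjoint_left]
        intro x hx hx'
        exact hpq (hdis p hp q hq x hx hx')
    · intro p hp
      obtain ⟨k, hk, rfl⟩ := Finset.mem_image.1 hp
      exact smul_lt hm (hs k hk)
    · intro p hp q hq x hxp hxq
      obtain ⟨k, hk, rfl⟩ := Finset.mem_image.1 hp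
      obtain ⟨k', hk', rfl⟩ := Finset.mem_image.1 hq
      simp only [φ] at hxp hxq
      rw [mem_cells_smul hm] at hxp hxq
      rw [hdis k hk k' hk' _ hxp hxq]
    · intro x
      rw [mem_cells_smul hm, hun]
      constructor
      · rintro ⟨p, hp, hx⟩
        refine ⟨_, Finset.mem_image_of_mem φ hp, ?_⟩
        simp only [φ]
        rwa [mem_cells_smul hm]
      · rintro ⟨p, hp, hx⟩
        obtain ⟨k, hk, rfl⟩ := Finset.mem_image.1 hp
        simp only [φ] at hx
        rw [mem_cells_smul hm] at hx
        exact ⟨k, hk, hx⟩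

theorem SA.unit_eq (h : SA P T F) {m : ℕ} (hm : 0 < m) :
    ∀ᵐ ω ∂P, ∀ k : Fin d → ℤ, F (m • k) (m • (k + 1)) ω = F 0 (fun _ => (m : ℤ)) (T (m • k) ω) := by
  rw [ae_all_iff]; intro k
  filter_upwards [h.equiv (m • k) 0 (fun _ => (m : ℤ)) (fun j => by simpa using hm)] with ω hω
  rw [hω, zero_add, smul_add, add_comm (m • k)]
  congr 2
  funext j; simp

theorem SA.red_eq (h : SA P T F) {m : ℕ} (hm : 0 < m) :
    ∀ᵐ ω ∂P, ∀ a b : Fin d → ℤ, redProc F m a b ω =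
      F (m • a) (m • b) ω - addProc (fun k => T (m • k)) (F 0 (fun _ => (m : ℤ))) a b ω := by
  filter_upwards [h.unit_eq hm] with ω hω a b
  simp only [redProc, addProc, hω]

theorem SA.red_integral (h : SA P T F) {m : ℕ} (hm : 0 < m) (a : Fin d → ℤ) (n : ℕ) (hn : 0 < n) :
    ∫ ω, redProc F m a (a + fun _ => (n : ℤ)) ω ∂P =
      ∫ ω, F (m • a) (m • a + fun _ => ((m * n : ℕ) : ℤ)) ω ∂P
        - (n : ℝ) ^ d * ∫ ω, F 0 (fun _ => (m : ℤ)) ω ∂P := by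
  have hpos : ∀ j, (0 : Fin d → ℤ) j < (fun _ => (m : ℤ)) j := fun j => by simpa using hm
  have hi := h.int 0 (fun _ => (m : ℤ)) hpos
  have hmp : ∀ k : Fin d → ℤ, MeasurePreserving (T (m • k)) P P := fun k => h.mp _
  have h1 : ∫ ω, redProc F m a (a + fun _ => (n : ℤ)) ω ∂P = ∫ ω, (F (m • a) (m • (a + fun _ => (n : ℤ))) ω
      - ∑ k ∈ cells a (a + fun _ => (n : ℤ)), F 0 (fun _ => (m : ℤ)) (T (m • k) ω)) ∂P := by
    refine integral_congr_ae ?_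
    filter_upwards [h.red_eq hm] with ω hω
    exact hω _ _
  rw [h1, integral_sub (h.int _ _ (smul_lt hm fun j => by simpa using hn))
    (integrable_finsetSum _ fun k _ => integrable_T (T := fun k => T (m • k)) hmp hi k),
    integral_finsetSum _ (fun k _ => integrable_T (T := fun k => T (m • k)) hmp hi k)]
  congr 1
  · congr 2
    funext ω
    congr 1
    funext j; simp [mul_add]
  · rw [Finset.sum_congr rfl fun k _ => integral_T (T := fun k => T (m • k)) hmp hi k,
      Finset.sum_const, card_cube, nsmul_eq_mul]
    push_cast; rfl

/-- Interpolation between multiples of `m`. -/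
theorem interp (u : ℕ → ℝ) (hu0 : ∀ l, 1 ≤ l → 0 ≤ u l)
    (hu : ∀ l l', 1 ≤ l → l ≤ l' → u l ≤ u l') (m : ℕ) (hm : 0 < m) (c α : ℝ) (hα : 0 < α)
    (h : ∀ᶠ q : ℕ in atTop, |u (m * q) / (2 * ((m * q : ℕ) : ℝ)) ^ d - c| ≤ α) :
    ∀ᶠ l : ℕ in atTop, |u l / (2 * (l : ℝ)) ^ d - c| ≤ 2 * α := by
  have hr : Tendsto (fun q : ℕ => (1 + 1 / (q : ℝ)) ^ d) atTop (𝓝 ((1 + 0) ^ d)) :=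
    (tendsto_const_nhds.add (tendsto_const_div_atTop_nhds_zero_nat _)).pow d
  have hr' : Tendsto (fun q : ℕ => ((1 + 1 / (q : ℝ)) ^ d)⁻¹) atTop (𝓝 ((1 + 0) ^ d)⁻¹) :=
    hr.inv₀ (by simp)
  simp only [add_zero, one_pow, inv_one] at hr hr'
  have e1 : ∀ᶠ q : ℕ in atTop, (c + α) * (1 + 1 / (q : ℝ)) ^ d < c + 2 * α := by
    have := hr.const_mul (c + α)
    exact this.eventually (gt_mem_nhds (by linarith))
  have e2 : ∀ᶠ q : ℕ in atTop, c - 2 * α < (c - α) * ((1 + 1 / (q : ℝ)) ^ d)⁻¹ := by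
    have := hr'.const_mul (c - α)
    exact this.eventually (lt_mem_nhds (by linarith))
  have h' := (tendsto_add_atTop_nat 1).eventually h
  have hdiv : Tendsto (fun l : ℕ => l / m) atTop atTop := Nat.tendsto_div_const_atTop hm.ne'
  filter_upwards [hdiv.eventually (e1.and (e2.and (h.and (h'.and (eventually_ge_atTop 1)))))]
    with l ⟨b1, b2, b3, b4, b5⟩
  set q := l / m with hq
  have hl1 : m * q ≤ l := Nat.mul_div_le l m
  have hl2 : l ≤ m * (q + 1) := (Nat.lt_mul_div_succ l hm).le
  have hmq : 1 ≤ m * q := Nat.mul_pos hm b5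
  have hl0 : 1 ≤ l := hmq.trans hl1
  have hq0 : (0 : ℝ) < q := by exact_mod_cast b5
  have hm0 : (0 : ℝ) < m := by exact_mod_cast hm
  have hlr : (0 : ℝ) < l := by exact_mod_cast hl0
  have hl1' : (m : ℝ) * q ≤ l := by exact_mod_cast hl1
  have hl2' : (l : ℝ) ≤ m * (q + 1) := by exact_mod_cast hl2
  have b3 := abs_le.1 b3
  have b4 := abs_le.1 b4
  push_cast at b3 b4
  have hkey : (2 * ((m : ℝ) * (q + 1))) ^ d = (1 + 1 / (q : ℝ)) ^ d * (2 * ((m : ℝ) * q)) ^ d := by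
    rw [← mul_pow]; congr 1; field_simp
  have hup : u l / (2 * (l : ℝ)) ^ d ≤ (c + α) * (1 + 1 / (q : ℝ)) ^ d := by
    calc u l / (2 * (l : ℝ)) ^ d ≤ u (m * (q + 1)) / (2 * ((m : ℝ) * q)) ^ d := by
          gcongr
          · exact hu0 _ (hl0.trans hl2)
          · exact hu _ _ hl0 hl2
      _ = u (m * (q + 1)) / (2 * ((m : ℝ) * (q + 1))) ^ d * (1 + 1 / (q : ℝ)) ^ d := by
          rw [hkey]; field_simp
      _ ≤ _ := by
          gcongr; linarith [b4.2]
  have hlo : (c - α) * ((1 + 1 / (q : ℝ)) ^ d)⁻¹ ≤ u l / (2 * (l : ℝ)) ^ d := by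
    calc (c - α) * ((1 + 1 / (q : ℝ)) ^ d)⁻¹
        ≤ u (m * q) / (2 * ((m : ℝ) * q)) ^ d * ((1 + 1 / (q : ℝ)) ^ d)⁻¹ := by
          gcongr; linarith [b3.1]
      _ = u (m * q) / (2 * ((m : ℝ) * (q + 1))) ^ d := by
          rw [hkey]; field_simp
      _ ≤ _ := by
          gcongr
          · exact hu0 _ hl0
          · exact hu _ _ hmq hl1
  rw [abs_le]; constructor <;> linarith

theorem SA.conv_nonneg [IsProbabilityMeasure P] (h : SA P T F)
    (hnn : ∀ a b : Fin d → ℤ, (∀ j, a j < b j) → ∀ᵐ ω ∂P, 0 ≤ F a b ω)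
    (C : ℝ) (hC : ∀ (a : Fin d → ℤ) (n : ℕ), 0 < n →
      ∫ ω, F a (a + fun _ => (n : ℤ)) ω ∂P ≤ C * (n : ℝ) ^ d) :
    ∀ᵐ ω ∂P, ∃ L : ℝ, Tendsto (fun l : ℕ =>
          F (fun _ => -(l : ℤ)) (fun _ => (l : ℤ)) ω / (2 * (l : ℝ)) ^ d) atTop (𝓝 L) := by
  have hpos : ∀ m : ℕ, 0 < m → ∀ j, (0 : Fin d → ℤ) j < (fun _ => (m : ℤ)) j :=
    fun m hm j => by simpa using hm
  -- the time constant
  let S : Set ℝ := {x | ∃ m : ℕ, 0 < m ∧ x = (∫ ω, F 0 (fun _ => (m : ℤ)) ω ∂P) / (m : ℝ) ^ d}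
  have hSb : BddAbove S := by
    refine ⟨C, ?_⟩
    rintro x ⟨m, hm, rfl⟩
    have hm' : (0 : ℝ) < m := by exact_mod_cast hm
    rw [div_le_iff₀ (by positivity)]
    have := hC 0 m hm
    rwa [zero_add] at this
  have hSn : S.Nonempty := ⟨_, 1, one_pos, rfl⟩
  set γ := sSup S with hγ
  have hγ1 : ∀ (a : Fin d → ℤ) (n : ℕ), 0 < n →
      ∫ ω, F a (a + fun _ => (n : ℤ)) ω ∂P ≤ γ * (n : ℝ) ^ d := by
    intro a n hn
    have hn' : (0 : ℝ) < n := by exact_mod_cast hn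
    have h1 := h.integral_shift a 0 (fun _ => (n : ℤ)) (hpos n hn)
    rw [zero_add, add_comm] at h1
    rw [h1, ← div_le_iff₀ (by positivity)]
    exact le_csSup hSb ⟨n, hn, rfl⟩
  -- monotonicity
  have hmono : ∀ᵐ ω ∂P, ∀ l l' : ℕ, 1 ≤ l → l ≤ l' →
      F (fun _ => -(l : ℤ)) (fun _ => (l : ℤ)) ω ≤ F (fun _ => -(l' : ℤ)) (fun _ => (l' : ℤ)) ω := by
    rw [ae_all_iff]; intro l
    rw [ae_all_iff]; intro l'
    by_cases hl : 1 ≤ l ∧ l ≤ l'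
    · filter_upwards [h.sub hnn {((fun _ => -(l : ℤ)), (fun _ => (l : ℤ)))}
        (fun _ => -(l' : ℤ)) (fun _ => (l' : ℤ))
        (by intro p hp; rw [Finset.mem_singleton] at hp; subst hp; intro j; simp; omega)
        (by intro j; omega)
        (by intro p hp q hq x _ _; rw [Finset.mem_singleton] at hp hq; rw [hp, hq])
        (by
          intro p hp x hx
          rw [Finset.mem_singleton] at hp; subst hp
          rw [mem_cells] at *
          intro j; have := hx j; simp at this; omega)] with ω hω _ _
      simpa using hω
    · exact Eventually.of_forall fun ω a b => absurd ⟨a, b⟩ hl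
  have hnn' : ∀ᵐ ω ∂P, ∀ l : ℕ, 1 ≤ l → 0 ≤ F (fun _ => -(l : ℤ)) (fun _ => (l : ℤ)) ω := by
    rw [ae_all_iff]; intro l
    by_cases hl : 1 ≤ l
    · filter_upwards [hnn (fun _ => -(l : ℤ)) (fun _ => (l : ℤ)) (fun j => by omega)] with ω hω _
      exact hω
    · exact Eventually.of_forall fun ω a => absurd a hl
  refine ae_converge_of_osc _ ?_
  intro α hα ε hε
  set β := α / 8 with hβ
  have hβ0 : 0 < β := by positivity
  set δ := ε * β / 3 ^ d with hδ
  have hδ0 : 0 < δ := by positivity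
  obtain ⟨x, ⟨m, hm, rfl⟩, hx⟩ := exists_lt_of_lt_csSup hSn (show γ - δ < sSup S by linarith)
  have hm' : (0 : ℝ) < m := by exact_mod_cast hm
  rw [lt_div_iff₀ (by positivity)] at hx
  have hR := h.toRed hm
  have hmax := hR.maximal (fun a b hab => h.red_nonneg hm a b hab) (δ * (m : ℝ) ^ d) ?_
    (β * (m : ℝ) ^ d) (by positivity)
  · have hconv := Conv.all hR.add hR.mp (h.int 0 (fun _ => (m : ℤ)) (hpos m hm))
    refine le_trans ?_ (hmax.trans (ENNReal.ofReal_le_ofReal (le_of_eq ?_)))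
    · apply measure_mono_ae
      have hrn : ∀ᵐ ω ∂P, ∀ l : ℕ, 1 ≤ l →
          0 ≤ redProc F m (fun _ => -(l : ℤ)) (fun _ => (l : ℤ)) ω := by
        rw [ae_all_iff]; intro l
        by_cases hl : 1 ≤ l
        · filter_upwards [h.red_nonneg hm (fun _ => -(l : ℤ)) (fun _ => (l : ℤ))
            (fun j => by omega)] with ω hω _
          exact hω
        · exact Eventually.of_forall fun ω a => absurd a hl
      filter_upwards [hconv, h.red_eq hm, hmono, hnn', hrn] with ω ⟨L, hL⟩ heq hmo hn0 hr0 hω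
      by_contra hcon
      apply hω
      have hcon : ∀ l : ℕ, 1 ≤ l → redProc F m (fun _ => -(l : ℤ)) (fun _ => (l : ℤ)) ω
          ≤ β * (m : ℝ) ^ d * (2 * (l : ℝ)) ^ d := by
        intro l hl
        by_contra hlt
        exact hcon ⟨l, hl, not_le.1 hlt⟩
      have hq : ∀ᶠ q : ℕ in atTop,
          |F (fun _ => -((m * q : ℕ) : ℤ)) (fun _ => ((m * q : ℕ) : ℤ)) ω
            / (2 * ((m * q : ℕ) : ℝ)) ^ d - L / (m : ℝ) ^ d| ≤ 2 * β := by
        have hL' := hL.div_const ((m : ℝ) ^ d)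
        have hev := hL'.eventually (Metric.ball_mem_nhds _ hβ0)
        filter_upwards [hev, eventually_ge_atTop 1] with q h1 h2
        have hq0 : (0 : ℝ) < q := by exact_mod_cast h2
        rw [Real.dist_eq] at h1
        have h3 := hcon q h2
        have h4 := hr0 q h2
        have ea : m • (fun _ => -(q : ℤ) : Fin d → ℤ) = fun _ => -((m * q : ℕ) : ℤ) := by
          funext j; simp
        have eb : m • (fun _ => (q : ℤ) : Fin d → ℤ) = fun _ => ((m * q : ℕ) : ℤ) := by
          funext j; simp
        rw [heq, ea, eb] at h3 h4
        rw [cavg] at h1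
        set X := F (fun _ => -((m * q : ℕ) : ℤ)) (fun _ => ((m * q : ℕ) : ℤ)) ω
        set Y := addProc (fun k => T (m • k)) (F 0 fun _ => (m : ℤ)) (fun _ => -(q : ℤ))
          (fun _ => (q : ℤ)) ω
        have e2 : (2 * ((m * q : ℕ) : ℝ)) ^ d = (m : ℝ) ^ d * (2 * (q : ℝ)) ^ d := by
          rw [← mul_pow]; push_cast; congr 1; ring
        have hp : (0 : ℝ) < (m : ℝ) ^ d * (2 * (q : ℝ)) ^ d := by positivity
        have h5 : 0 ≤ X / ((m : ℝ) ^ d * (2 * (q : ℝ)) ^ d) - Y / ((m : ℝ) ^ d * (2 * (q : ℝ)) ^ d) := by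
          rw [← sub_div]; positivity
        have h6 : X / ((m : ℝ) ^ d * (2 * (q : ℝ)) ^ d) - Y / ((m : ℝ) ^ d * (2 * (q : ℝ)) ^ d) ≤ β := by
          rw [← sub_div, div_le_iff₀ hp]; linarith
        have h7 : Y / (2 * (q : ℝ)) ^ d / (m : ℝ) ^ d = Y / ((m : ℝ) ^ d * (2 * (q : ℝ)) ^ d) := by
          rw [div_div, mul_comm]
        rw [h7] at h1
        have h1 := abs_lt.1 h1
        rw [e2, abs_le]; constructor <;> linarith
      have hfin := interp (d := d) (fun l => F (fun _ => -(l : ℤ)) (fun _ => (l : ℤ)) ω)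
        hn0 hmo m hm _ _ (by positivity) hq
      obtain ⟨N, hN⟩ := hfin.exists_forall_of_atTop
      refine ⟨N, fun n hn k hk => ?_⟩
      have a1 := abs_le.1 (hN n hn)
      have a2 := abs_le.1 (hN k hk)
      rw [abs_le]; constructor <;> linarith
    · rw [hδ]; field_simp
  · intro a n hn
    have hn' : (0 : ℝ) < n := by exact_mod_cast hn
    rw [h.red_integral hm a n hn]
    have h1 := hγ1 (m • a) (m * n) (Nat.mul_pos hm hn)
    push_cast at h1 ⊢
    rw [mul_pow] at h1
    have h2 : (n : ℝ) ^ d * ((γ - δ) * (m : ℝ) ^ d)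
        ≤ (n : ℝ) ^ d * ∫ ω, F 0 (fun _ => (m : ℤ)) ω ∂P := by gcongr
    linarith

end

/-- Akcoglu–Krengel superadditive ergodic theorem (as used in the paper). -/
theorem akcoglu_krengel_superadditive
    {d : ℕ} {Ω : Type*} [MeasurableSpace Ω] (P : Measure Ω) [IsProbabilityMeasure P]
    (T : (Fin d → ℤ) → Ω → Ω)
    (hT0 : T 0 = id)
    (hTadd : ∀ j k : Fin d → ℤ, T (j + k) = T j ∘ T k)
    (hTmp : ∀ k : Fin d → ℤ, MeasurePreserving (T k) P P)
    (F : (Fin d → ℤ) → (Fin d → ℤ) → Ω → ℝ)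
    (hint : ∀ a b : Fin d → ℤ, (∀ j, a j < b j) → Integrable (F a b) P)
    (hequiv : ∀ (k a b : Fin d → ℤ), (∀ j, a j < b j) →
      ∀ᵐ ω ∂P, F a b (T k ω) = F (a + k) (b + k) ω)
    (hsuper : ∀ (n : ℕ) (a b : Fin n → Fin d → ℤ) (A B : Fin d → ℤ),
      (∀ i j, a i j < b i j) → (∀ j, A j < B j) →
      Pairwise (Function.onFun Disjoint (fun i => intBox d (a i) (b i))) →
      intBox d A B = interior (⋃ i, closure (intBox d (a i) (b i))) →
      ∀ᵐ ω ∂P, (∑ i, F (a i) (b i) ω) ≤ F A B ω)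
    (hbdd : ∃ C : ℝ, ∀ a b : Fin d → ℤ, (∀ j, a j < b j) →
      (∫ ω, F a b ω ∂P) / (∏ j, ((b j : ℝ) - (a j : ℝ))) ≤ C) :
    ∀ᵐ ω ∂P, ∃ L : ℝ,
      Tendsto (fun l : ℕ =>
          F (fun _ => -(l : ℤ)) (fun _ => (l : ℤ)) ω / (2 * (l : ℝ))^d)
        atTop (𝓝 L) := by
  have h : SA P T F := SA.of_frozen P T hTadd hTmp F hint hequiv hsuper
  obtain ⟨C, hC⟩ := hbdd
  have h1 := h.toRed one_pos
  have hi := h.int 0 (fun _ => ((1 : ℕ) : ℤ)) (fun j => by simp)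
  have hcv := h1.conv_nonneg (fun a b hab => h.red_nonneg one_pos a b hab)
    (C - ∫ ω, F 0 (fun _ => ((1 : ℕ) : ℤ)) ω ∂P) ?_
  · have hav := Conv.all h1.add h1.mp hi
    filter_upwards [hcv, hav, h.red_eq one_pos] with ω ⟨L, hL⟩ ⟨M, hM⟩ heq
    refine ⟨L + M, (hL.add hM).congr fun l => ?_⟩
    rw [heq, cavg, ← add_div, one_smul, one_smul, sub_add_cancel]
  · intro a n hn
    have hn' : (0 : ℝ) < n := by exact_mod_cast hn
    rw [h.red_integral one_pos a n hn]
    have h2 := hC a (a + fun _ => (n : ℤ)) (fun j => by simpa using hn)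
    simp only [Pi.add_apply, Int.cast_add, Int.cast_natCast, add_sub_cancel_left,
      Finset.prod_const, Finset.card_univ, Fintype.card_fin] at h2
    rw [div_le_iff₀ (by positivity)] at h2
    rw [one_smul, one_mul]
    linarith
end
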